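/- arXiv:1403.1951 — 3 statements merged into one kernel-verified Lean document; each statement's English description precedes it below -/
import Mathlib

section
/- Let h be a solution of rank n−1 of two word equations E and E' in n unknowns, and let λ ∈ ℤⁿ be a vector with coprime coefficients such that Γ_h = {u ∈ ℚⁿ : λ·u = 0}. Then for each j,k = 1,…,n the determinant t_{jk}^{E,E'} = S_{E,x_j}S_{E',x_k} − S_{E',x_j}S_{E,x_k} is divisible by X^{λ⁺} − X^{λ⁻} in ℤ[X₁,…,Xₙ]. In particular, 𝒮_E(β) and 𝒮_{E'}(β) are linearly dependent over ℚ(x) for each β ∈ Γ_h ∩ ℕ₀ⁿ. -/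
open scoped BigOperators

namespace WordEquations

/-- The set of letters occurring in the images of a (letter-image) morphism. -/
def alph {Ξ Δ : Type*} (h : Ξ → List Δ) : Set Δ := ⋃ x, {a | a ∈ h x}

/-- `h` is a solution of the system `T` of word equations. -/
def IsSolution {Ξ A : Type*} (h : Ξ → List A) (T : Set (List Ξ × List Ξ)) : Prop :=
  ∀ e ∈ T, e.1.flatMap h = e.2.flatMap h

/-- `h` is a solution of the single word equation `E`. -/
def IsSolutionE {Ξ A : Type*} (h : Ξ → List A) (E : List Ξ × List Ξ) : Prop :=
  E.1.flatMap h = E.2.flatMap h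

/-- `θ` is a renaming of letters on the set `S`: it maps each letter of `S` to a
single letter, injectively on `S`. -/
def IsRenamingOn {A B : Type*} (θ : A → List B) (S : Set A) : Prop :=
  (∀ a ∈ S, ∃ b, θ a = [b]) ∧ ∀ a₁ ∈ S, ∀ a₂ ∈ S, θ a₁ = θ a₂ → a₁ = a₂

/-- `g` is a principal solution of `T`: whenever `g = θ ∘ g'` for a solution `g'`
(and a morphism `θ` non-erasing on `alph g'`), `θ` is a renaming of letters. -/
def IsPrincipalSolution {Ξ Δ : Type*} (g : Ξ → List Δ) (T : Set (List Ξ × List Ξ)) : Prop :=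
  IsSolution g T ∧
  ∀ (Δ' : Type) (g' : Ξ → List Δ') (θ : Δ' → List Δ),
    IsSolution g' T → (∀ a ∈ alph g', θ a ≠ []) →
    (∀ x, g x = (g' x).flatMap θ) → IsRenamingOn θ (alph g')

/-- The vector `γ(h)_a = (|h(x₁)|_a, …, |h(xₙ)|_a) ∈ ℚⁿ`. -/
def gamVec {n : ℕ} {Δ : Type*} [DecidableEq Δ] (h : Fin n → List Δ) (a : Δ) :
    Fin n → ℚ := fun j => ((h j).count a : ℚ)

/-- `Γ_h`, the ℚ-span of the vectors `γ(h)_a`. -/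
noncomputable def GammaSpace {n : ℕ} {Δ : Type*} [DecidableEq Δ] (h : Fin n → List Δ) :
    Submodule ℚ (Fin n → ℚ) := Submodule.span ℚ (Set.range (gamVec h))

/-- The rank of a morphism: `dim Γ_h`. -/
noncomputable def morphRank {n : ℕ} {Δ : Type*} [DecidableEq Δ] (h : Fin n → List Δ) : ℕ :=
  Module.finrank ℚ ↥(GammaSpace h)

/-- `Mℕ`: all finite nonempty sums `Σᵢ aᵢ αᵢ` with `aᵢ` positive integers and `αᵢ ∈ M`
(equivalently, nonempty finite sums of elements of `M` with repetitions). -/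
def natSums {n : ℕ} (M : Set (Fin n → ℚ)) : Set (Fin n → ℚ) :=
  {v | ∃ l : List (Fin n → ℚ), l ≠ [] ∧ (∀ x ∈ l, x ∈ M) ∧ l.sum = v}

/-- `M ⊆ ℚⁿ` has rank `r`: the ℚ-span of `M` has dimension `r`, and `M` is not contained
in any finite union of `(r-1)`-dimensional subspaces of its span. -/
def HasRank {n : ℕ} (M : Set (Fin n → ℚ)) (r : ℕ) : Prop :=
  Module.finrank ℚ ↥(Submodule.span ℚ M) = r ∧
  ∀ V : Finset (Submodule ℚ (Fin n → ℚ)),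
    (∀ W ∈ V, W ≤ Submodule.span ℚ M ∧ Module.finrank ℚ ↥W + 1 = r) →
    ¬ M ⊆ ⋃ W ∈ V, (W : Set (Fin n → ℚ))

/-- The monomial `X^α = ∏ᵢ Xᵢ^{αᵢ}` in `ℤ[X₁,…,Xₙ]`. -/
noncomputable def Xpow {n : ℕ} (α : Fin n → ℕ) : MvPolynomial (Fin n) ℤ :=
  ∏ i, MvPolynomial.X i ^ α i

/-- The polynomial `Σ_{a : w_a = j} ∏_{t<a} X_{w_t}` associated with one side of an equation. -/
noncomputable def sideS {n : ℕ} (w : List (Fin n)) (j : Fin n) : MvPolynomial (Fin n) ℤ :=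
  ∑ a : Fin w.length, if w.get a = j then ((w.take (a : ℕ)).map MvPolynomial.X).prod else 0

/-- The polynomial `S_{E,x_j}` of the equation `E = (u,v)`. -/
noncomputable def SE {n : ℕ} (E : List (Fin n) × List (Fin n)) (j : Fin n) :
    MvPolynomial (Fin n) ℤ :=
  sideS E.1 j - sideS E.2 j

/-- Evaluation `p ↦ p(β)`, induced by `Xᵢ ↦ x^{βᵢ}`. -/
noncomputable def evalAt {n : ℕ} (β : Fin n → ℕ) (p : MvPolynomial (Fin n) ℤ) : Polynomial ℤ :=
  MvPolynomial.eval₂ (Int.castRingHom (Polynomial ℤ)) (fun i => Polynomial.X ^ β i) p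

/-- `λ⁺`, the positive part of an integer vector. -/
def lamPos {n : ℕ} (lam : Fin n → ℤ) : Fin n → ℕ := fun i => (lam i).toNat

/-- `λ⁻`, the negative part of an integer vector. -/
def lamNeg {n : ℕ} (lam : Fin n → ℤ) : Fin n → ℕ := fun i => (-(lam i)).toNat

/-- The length type `L(θ_α ∘ h)` of the composition of `h` with the power morphism
`θ_α : aᵢ ↦ aᵢ^{αᵢ}`. -/
def powLenType {n k : ℕ} (α : Fin k → ℕ) (h : Fin n → List (Fin k)) : Fin n → ℕ :=
  fun x => ∑ a, α a * (h x).count a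

/-- The field `ℚ(x)`, realized as the field of fractions of `ℤ[x]`. -/
noncomputable abbrev RatX : Type := FractionRing (Polynomial ℤ)

/-- The vector `𝒮_E(β) ∈ ℚ(x)ⁿ`. -/
noncomputable def SEvec {n : ℕ} (E : List (Fin n) × List (Fin n)) (β : Fin n → ℕ) :
    Fin n → RatX :=
  fun j => algebraMap (Polynomial ℤ) RatX (evalAt β (SE E j))

/-- The set of exponents of the minimal monomials of `p` (exponents in the support of `p`
that are minimal with respect to the componentwise order). -/
noncomputable def minimalSupport {n : ℕ} (p : MvPolynomial (Fin n) ℤ) : Finset (Fin n →₀ ℕ) :=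
  p.support.filter (fun β => ∀ β' ∈ p.support, β' ≤ β → β' = β)


section helpers

open MvPolynomial

lemma sideS_nil {n : ℕ} (j : Fin n) : sideS ([] : List (Fin n)) j = 0 := by
  simp [sideS]

lemma sideS_cons {n : ℕ} (x : Fin n) (w : List (Fin n)) (j : Fin n) :
    sideS (x :: w) j = (if x = j then 1 else 0) + X x * sideS w j := by
  unfold sideS
  rw [Finset.mul_sum]
  refine (Fin.sum_univ_succ (n := w.length) _).trans ?_
  congr 1
  refine Finset.sum_congr rfl fun i _ => ?_
  simp

lemma sideS_append {n : ℕ} (u v : List (Fin n)) (j : Fin n) :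
    sideS (u ++ v) j = sideS u j + (u.map X).prod * sideS v j := by
  induction u with
  | nil => simp [sideS_nil]
  | cons x u ih =>
    simp only [List.cons_append, sideS_cons, ih, List.map_cons, List.prod_cons]
    ring

/-- Substitution `X_i ↦ ∏_{letters of h(x_i)} Y_a`. -/
noncomputable def phi {n m : ℕ} (h : Fin n → List (Fin m)) :
    MvPolynomial (Fin n) ℤ →ₐ[ℤ] MvPolynomial (Fin m) ℤ :=
  aeval (fun i => ((h i).map X).prod)

lemma sideS_flatMap {n m : ℕ} (h : Fin n → List (Fin m)) (w : List (Fin n)) (a : Fin m) :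
    sideS (w.flatMap h) a = ∑ j, phi h (sideS w j) * sideS (h j) a := by
  induction w with
  | nil => simp [sideS_nil]
  | cons x w ih =>
    rw [List.flatMap_cons, sideS_append, ih, Finset.mul_sum]
    have : ∀ j, phi h (sideS (x :: w) j) * sideS (h j) a
        = (if x = j then sideS (h j) a else 0)
          + ((h x).map X).prod * (phi h (sideS w j) * sideS (h j) a) := by
      intro j
      rw [sideS_cons, map_add, map_mul]
      have : phi h (X x) = ((h x).map X).prod := by simp [phi]
      rw [this]
      split_ifs <;> simp <;> ring
    simp_rw [this, Finset.sum_add_distrib]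
    simp

lemma sideS_eval_one {m : ℕ} (w : List (Fin m)) (a : Fin m) :
    eval (fun _ => (1 : ℤ)) (sideS w a) = w.count a := by
  induction w with
  | nil => simp [sideS_nil]
  | cons x w ih =>
    rw [sideS_cons, map_add, map_mul, ih, List.count_cons]
    by_cases hx : x = a <;> simp [hx, add_comm]

lemma phi_SE {n m : ℕ} (h : Fin n → List (Fin m)) (E : List (Fin n) × List (Fin n))
    (hE : IsSolutionE h E) (a : Fin m) :
    ∑ j, phi h (SE E j) * sideS (h j) a = 0 := by
  have h1 := sideS_flatMap h E.1 a
  have h2 := sideS_flatMap h E.2 a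
  unfold IsSolutionE at hE
  rw [hE] at h1
  simp only [SE, map_sub, sub_mul, Finset.sum_sub_distrib]
  rw [← h1, ← h2, sub_self]

lemma dep_of_matrix {n : ℕ} {R K : Type*} [CommRing R] [IsDomain R] [Field K] (ε : R →+* K)
    (M : Matrix (Fin n) (Fin n) R) (hM : ε.mapMatrix M = 1)
    (v w c : Fin n → R) (s t : R)
    (hv : Matrix.vecMul v M = s • c) (hw : Matrix.vecMul w M = t • c) (j k : Fin n) :
    v j * w k = w j * v k := by
  have hdet : M.det ≠ 0 := by
    intro h0
    have := RingHom.map_det ε M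
    rw [hM, h0] at this
    simp at this
  have inj : ∀ u : Fin n → R, Matrix.vecMul u M = 0 → u = 0 :=
    fun u hu => Matrix.eq_zero_of_vecMul_eq_zero hdet hu
  have key : t • v - s • w = 0 := by
    apply inj
    rw [Matrix.sub_vecMul, Matrix.smul_vecMul, Matrix.smul_vecMul, hv, hw, smul_smul, smul_smul,
      mul_comm, sub_self]
  have key' : ∀ i, t * v i = s * w i := fun i => by
    have := congrFun key i
    simpa [sub_eq_zero] using this
  by_cases ht : t = 0
  · have : w = 0 := inj w (by rw [hw, ht, zero_smul])
    simp [this]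
  · apply mul_left_cancel₀ ht
    linear_combination (w k) * key' j - (w j) * key' k

lemma phi_det {n m : ℕ} (h : Fin n → List (Fin m))
    (E E' : List (Fin n) × List (Fin n))
    (hE : IsSolutionE h E) (hE' : IsSolutionE h E')
    (lam : Fin n → ℤ) (hcop : Finset.univ.gcd lam = 1)
    (hΓ : ∀ u : Fin n → ℚ, u ∈ GammaSpace h ↔ ∑ i, (lam i : ℚ) * u i = 0) (j k : Fin n) :
    phi h (SE E j * SE E' k - SE E' j * SE E k) = 0 := by
  classical
  set N : ℚ := ∑ i, (lam i : ℚ) * lam i with hN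
  have hN0 : N ≠ 0 := by
    intro h0
    rw [hN, Finset.sum_eq_zero_iff_of_nonneg (fun i _ => mul_self_nonneg _)] at h0
    have : Finset.univ.gcd lam = 0 := by
      rw [Finset.gcd_eq_zero_iff]
      intro i hi
      simpa using h0 i hi
    rw [hcop] at this
    exact one_ne_zero this
  have hex : ∀ i : Fin n, ∃ C : Fin m → ℚ,
      ∑ a, C a • gamVec h a = fun l => (if l = i then 1 else 0) - lam l * (lam i / N) := by
    intro i
    have : (fun l => (if l = i then 1 else 0) - lam l * (lam i / N) : Fin n → ℚ) ∈
        GammaSpace h := by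
      rw [hΓ]
      simp only [mul_sub, Finset.sum_sub_distrib, ← mul_assoc]
      rw [← Finset.sum_mul, ← hN]
      simp
      field_simp
      simp
    exact (Submodule.mem_span_range_iff_exists_fun ℚ).1 this
  choose C hC using hex
  let ι : MvPolynomial (Fin m) ℤ →+* MvPolynomial (Fin m) ℚ := MvPolynomial.map (Int.castRingHom ℚ)
  have hι : Function.Injective ι := MvPolynomial.map_injective _ Int.cast_injective
  let ε : MvPolynomial (Fin m) ℚ →+* ℚ := MvPolynomial.eval (fun _ => (1 : ℚ))
  have hε : ∀ p, ε (ι p) = ((eval (fun _ => (1 : ℤ)) p : ℤ) : ℚ) := by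
    intro p
    have := MvPolynomial.map_eval (Int.castRingHom ℚ) (fun _ => (1 : ℤ)) p
    simp only [ε, ι]
    simpa [Function.comp_def] using this.symm
  let M : Matrix (Fin n) (Fin n) (MvPolynomial (Fin m) ℚ) := Matrix.of fun l i =>
    ∑ a, ι (sideS (h l) a) * MvPolynomial.C (C i a)
      + MvPolynomial.C (lam l : ℚ) * MvPolynomial.C (lam i / N)
  have hM : ε.mapMatrix M = 1 := by
    ext l i
    have h1 := congrFun (hC i) l
    simp only [Finset.sum_apply, Pi.smul_apply, smul_eq_mul, gamVec] at h1
    have h2 : ∀ q : ℚ, ε (MvPolynomial.C q) = q := fun q => by simp [ε]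
    simp only [RingHom.mapMatrix_apply, Matrix.map_apply, M, Matrix.of_apply, map_add, map_sum,
      map_mul, hε, sideS_eval_one, h2, Matrix.one_apply]
    simp only [mul_comm _ (C i _), Int.cast_natCast]
    rw [h1]
    ring
  have hv : ∀ F : List (Fin n) × List (Fin n), IsSolutionE h F →
      Matrix.vecMul (fun l => ι (phi h (SE F l))) M =
        (∑ l, ι (phi h (SE F l)) * MvPolynomial.C (lam l : ℚ)) •
          (fun i => MvPolynomial.C (lam i / N)) := by
    intro F hF
    ext1 i
    simp only [Matrix.vecMul, dotProduct, M, Matrix.of_apply, mul_add, Finset.sum_add_distrib,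
      Pi.smul_apply, smul_eq_mul, Finset.sum_mul, Finset.mul_sum]
    rw [Finset.sum_comm]
    have : ∀ a, ∑ l, ι (phi h (SE F l)) * (ι (sideS (h l) a) * MvPolynomial.C (C i a)) = 0 := by
      intro a
      have h0 := congrArg ι (phi_SE h F hF a)
      rw [map_sum, map_zero] at h0
      simp only [map_mul] at h0
      simp only [← mul_assoc]
      rw [← Finset.sum_mul, h0, zero_mul]
    simp only [this, Finset.sum_const_zero, zero_add, mul_assoc]
  have := dep_of_matrix ε M hM _ _ _ _ _ (hv E hE) (hv E' hE') j k
  rw [map_sub, map_mul, map_mul, sub_eq_zero]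
  apply hι
  simpa only [map_mul] using this

lemma dvd_of_fibre_aux {n : ℕ} (lam : Fin n → ℤ) (α α' : Fin n → ℕ) (k : ℕ)
    (hk : ∀ i, (α i : ℤ) - α' i = k * lam i) :
    (Xpow (lamPos lam) - Xpow (lamNeg lam)) ∣ Xpow α - Xpow α' := by
  have hδ : ∀ i, ∃ δ : ℕ, α i = δ + lamPos lam i * k ∧ α' i = δ + lamNeg lam i * k := by
    intro i
    rcases le_total 0 (lam i) with hl | hl
    · obtain ⟨q, hq⟩ := Int.eq_ofNat_of_zero_le hl
      refine ⟨α' i, ?_, ?_⟩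
      · have := hk i
        simp only [lamPos, hq, Int.toNat_natCast] at this ⊢
        zify
        linarith
      · simp [lamNeg, hq]
    · obtain ⟨q, hq⟩ := Int.eq_ofNat_of_zero_le (neg_nonneg.2 hl)
      have hq' : lam i = -q := by omega
      refine ⟨α i, ?_, ?_⟩
      · simp [lamPos, hq']
      · have := hk i
        simp only [lamNeg, hq', neg_neg, Int.toNat_natCast] at this ⊢
        zify
        linarith
  choose δ h1 h2 using hδ
  have e : ∀ (β γ : Fin n → ℕ), (∀ i, β i = δ i + γ i * k) → Xpow β = Xpow δ * Xpow γ ^ k := by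
    intro β γ hβ
    simp only [Xpow, hβ, pow_add, pow_mul, Finset.prod_mul_distrib, Finset.prod_pow]
  rw [e α _ h1, e α' _ h2, ← mul_sub]
  exact Dvd.dvd.mul_left (sub_dvd_pow_sub_pow _ _ _) _

lemma dvd_of_fibre {n m : ℕ} (h : Fin n → List (Fin m))
    (lam : Fin n → ℤ) (hcop : Finset.univ.gcd lam = 1)
    (hΓ : ∀ u : Fin n → ℚ, u ∈ GammaSpace h ↔ ∑ i, (lam i : ℚ) * u i = 0)
    (α α' : Fin n → ℕ)
    (hαα : ∀ a, ∑ i, α i * (h i).count a = ∑ i, α' i * (h i).count a) :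
    (Xpow (lamPos lam) - Xpow (lamNeg lam)) ∣ Xpow α - Xpow α' := by
  classical
  have hvan : ∀ u ∈ GammaSpace h, ∑ i, ((α i : ℚ) - α' i) * u i = 0 := by
    intro u hu
    refine Submodule.span_induction (p := fun u _ => ∑ i, ((α i : ℚ) - α' i) * u i = 0)
      ?_ ?_ ?_ ?_ hu
    · rintro _ ⟨a, rfl⟩
      have := hαα a
      have h2 : (∑ i, (α i : ℚ) * (h i).count a) = ∑ i, (α' i : ℚ) * (h i).count a := by
        exact_mod_cast this
      simp only [gamVec, sub_mul, Finset.sum_sub_distrib]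
      rw [h2, sub_self]
    · simp
    · intro x y _ _ hx hy
      simp only [Pi.add_apply, mul_add, Finset.sum_add_distrib]
      rw [hx, hy, add_zero]
    · intro r x _ hx
      simp only [Pi.smul_apply, smul_eq_mul, mul_left_comm _ r, ← Finset.mul_sum]
      rw [hx, mul_zero]
  have hcross : ∀ i j, lam i * ((α j : ℤ) - α' j) = lam j * ((α i : ℤ) - α' i) := by
    intro i j
    have hu : (fun l => (lam i : ℚ) * (if l = j then 1 else 0) - lam j * (if l = i then 1 else 0))
        ∈ GammaSpace h := by
      rw [hΓ]
      simp [mul_sub, Finset.sum_sub_distrib, mul_comm]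
    have := hvan _ hu
    simp [mul_sub, Finset.sum_sub_distrib] at this
    have h3 : ((lam i * ((α j : ℤ) - α' j) : ℤ) : ℚ) = (lam j * ((α i : ℤ) - α' i) : ℤ) := by
      push_cast
      linarith
    exact_mod_cast h3
  obtain ⟨c, hc⟩ : ∃ c : Fin n → ℤ, ∑ i, c i * lam i = 1 := by
    have : (1 : ℤ) ∈ Ideal.span (Set.range lam) := by
      obtain ⟨g, hg⟩ := (IsPrincipalIdealRing.principal (Ideal.span (Set.range lam))).principal
      have hdvd : g ∣ Finset.univ.gcd lam := by
        apply Finset.dvd_gcd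
        intro i _
        have : lam i ∈ Ideal.span (Set.range lam) := Ideal.subset_span ⟨i, rfl⟩
        rw [hg] at this
        exact Ideal.mem_span_singleton.1 this
      rw [hcop] at hdvd
      rw [hg]
      exact Ideal.mem_span_singleton.2 hdvd
    obtain ⟨c, hc⟩ := (Submodule.mem_span_range_iff_exists_fun ℤ).1 this
    exact ⟨c, by simpa using hc⟩
  set K : ℤ := ∑ i, c i * ((α i : ℤ) - α' i) with hK
  have hKl : ∀ j, (α j : ℤ) - α' j = K * lam j := by
    intro j
    calc (α j : ℤ) - α' j = (∑ i, c i * lam i) * ((α j : ℤ) - α' j) := by rw [hc, one_mul]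
      _ = ∑ i, c i * ((α i : ℤ) - α' i) * lam j := by
        rw [Finset.sum_mul]
        refine Finset.sum_congr rfl fun i _ => ?_
        linear_combination (c i) * hcross i j
      _ = K * lam j := by rw [hK, Finset.sum_mul]
  rcases le_total 0 K with hp | hp
  · obtain ⟨k, hk⟩ := Int.eq_ofNat_of_zero_le hp
    exact dvd_of_fibre_aux lam α α' k (fun i => by rw [hKl i, hk])
  · obtain ⟨k, hk⟩ := Int.eq_ofNat_of_zero_le (neg_nonneg.2 hp)
    rw [dvd_sub_comm]
    refine dvd_of_fibre_aux lam α' α k (fun i => ?_)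
    rw [← hk]
    linarith [hKl i]

lemma map_X_prod {m : ℕ} (w : List (Fin m)) :
    (w.map X).prod = (monomial (Finsupp.equivFunOnFinite.symm fun a => w.count a) 1 :
      MvPolynomial (Fin m) ℤ) := by
  induction w with
  | nil =>
    rw [List.map_nil, List.prod_nil, ← MvPolynomial.C_1, ← MvPolynomial.monomial_zero']
    congr 2
    ext a
    simp
  | cons x w ih =>
    rw [List.map_cons, List.prod_cons, ih, X, monomial_mul, one_mul]
    congr 2
    ext a
    by_cases hx : x = a <;> simp [List.count_cons, hx, Finsupp.single_apply, add_comm]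

lemma monomial_eq_Xpow {n : ℕ} (α : Fin n →₀ ℕ) :
    (monomial α 1 : MvPolynomial (Fin n) ℤ) = Xpow α := by
  rw [monomial_eq, Xpow, Finsupp.prod_fintype _ _ (by simp)]
  simp

lemma phi_monomial {n m : ℕ} (h : Fin n → List (Fin m)) (α : Fin n →₀ ℕ) :
    phi h (monomial α 1) =
      monomial (Finsupp.equivFunOnFinite.symm fun a => ∑ i, α i * (h i).count a) 1 := by
  rw [monomial_eq_Xpow, Xpow, map_prod]
  have : ∀ i, phi h (X i ^ α i) =
      monomial (α i • Finsupp.equivFunOnFinite.symm fun a => (h i).count a) 1 := by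
    intro i
    rw [map_pow, phi, aeval_X, map_X_prod, monomial_pow, one_pow]
  simp only [this]
  rw [← MvPolynomial.monomial_sum_one]
  congr 2
  ext a
  simp [Finsupp.finsetSum_apply]

lemma dvd_of_phi_eq_zero {n m : ℕ} (h : Fin n → List (Fin m))
    (lam : Fin n → ℤ) (hcop : Finset.univ.gcd lam = 1)
    (hΓ : ∀ u : Fin n → ℚ, u ∈ GammaSpace h ↔ ∑ i, (lam i : ℚ) * u i = 0)
    (p : MvPolynomial (Fin n) ℤ) (hp : phi h p = 0) :
    (Xpow (lamPos lam) - Xpow (lamNeg lam)) ∣ p := by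
  classical
  set d := Xpow (lamPos lam) - Xpow (lamNeg lam) with hd
  let q := (Ideal.Quotient.mkₐ ℤ (Ideal.span {d})).toLinearMap
  have hq : ∀ r, q r = 0 ↔ d ∣ r := by
    intro r
    rw [← Ideal.mem_span_singleton]
    exact Ideal.Quotient.eq_zero_iff_mem
  let T : (Fin n →₀ ℕ) → (Fin m →₀ ℕ) := fun α =>
    Finsupp.equivFunOnFinite.symm fun a => ∑ i, α i * (h i).count a
  let F : (Fin m →₀ ℕ) → (MvPolynomial (Fin n) ℤ ⧸ Ideal.span {d}) := fun b =>
    if hb : ∃ α, T α = b then q (monomial hb.choose 1) else 0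
  let G := (basisMonomials (Fin m) ℤ).constr ℤ F
  have hG : ∀ b, G (monomial b 1) = F b := by
    intro b
    have := (basisMonomials (Fin m) ℤ).constr_basis ℤ F b
    simpa [G] using this
  have hF : ∀ α, F (T α) = q (monomial α 1) := by
    intro α
    have hb : ∃ α', T α' = T α := ⟨α, rfl⟩
    have hs := hb.choose_spec
    simp only [F, dif_pos hb]
    rw [← sub_eq_zero, ← map_sub, hq, monomial_eq_Xpow, monomial_eq_Xpow]
    refine dvd_of_fibre h lam hcop hΓ _ _ fun a => ?_
    have := DFunLike.congr_fun hs a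
    simpa [T] using this
  have hcomp : G ∘ₗ (phi h).toLinearMap = q := by
    refine (basisMonomials (Fin n) ℤ).ext fun α => ?_
    simp only [coe_basisMonomials, LinearMap.comp_apply, AlgHom.toLinearMap_apply, phi_monomial]
    rw [hG]
    exact hF α
  rw [← hq, ← hcomp]
  simp [hp]

lemma not_linInd {n : ℕ} {K : Type*} [Field K] (v w : Fin n → K)
    (hvw : ∀ j k, v j * w k = w j * v k) : ¬ LinearIndependent K ![v, w] := by
  intro hli
  rw [LinearIndependent.pair_iff] at hli
  have hw : w = 0 := by
    ext k
    exact (hli (w k) (-(v k)) (by ext j; simp; linear_combination hvw j k)).1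
  have := hli 0 1 (by simp [hw])
  simp at this

lemma evalAt_eq {n : ℕ} (β : Fin n → ℕ) (p : MvPolynomial (Fin n) ℤ) :
    evalAt β p = eval₂Hom (Int.castRingHom (Polynomial ℤ)) (fun i => Polynomial.X ^ β i) p := rfl

lemma evalAt_Xpow {n : ℕ} (β α : Fin n → ℕ) :
    evalAt β (Xpow α) = Polynomial.X ^ (∑ i, β i * α i) := by
  rw [evalAt_eq, Xpow, map_prod, ← Finset.prod_pow_eq_pow_sum]
  simp [pow_mul]

end helpers

/-- if `h` is a solution of rank `n-1` of `E` and `E'` and `λ` has coprime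
coefficients with `Γ_h = {u : λ·u = 0}`, then every determinant `t_{jk}^{E,E'}` is divisible
by `X^{λ⁺} - X^{λ⁻}`; in particular `𝒮_E(β)` and `𝒮_{E'}(β)` are linearly dependent over
`ℚ(x)` for each `β ∈ Γ_h ∩ ℕ₀ⁿ`. -/
theorem det_dvd_of_solution {n m : ℕ} (h : Fin n → List (Fin m))
    (E E' : List (Fin n) × List (Fin n))
    (hE : IsSolutionE h E) (hE' : IsSolutionE h E')
    (hrank : morphRank h = n - 1)
    (lam : Fin n → ℤ) (hcop : Finset.univ.gcd lam = 1)
    (hΓ : ∀ u : Fin n → ℚ, u ∈ GammaSpace h ↔ ∑ i, (lam i : ℚ) * u i = 0) :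
    (∀ j k : Fin n,
      (Xpow (lamPos lam) - Xpow (lamNeg lam)) ∣ (SE E j * SE E' k - SE E' j * SE E k)) ∧
    (∀ β : Fin n → ℕ, (fun i => ((β i : ℕ) : ℚ)) ∈ GammaSpace h →
      ¬ LinearIndependent RatX ![SEvec E β, SEvec E' β]) := by
  have h1 : ∀ j k : Fin n,
      (Xpow (lamPos lam) - Xpow (lamNeg lam)) ∣ (SE E j * SE E' k - SE E' j * SE E k) :=
    fun j k => dvd_of_phi_eq_zero h lam hcop hΓ _ (phi_det h E E' hE hE' lam hcop hΓ j k)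
  refine ⟨h1, fun β hβ => not_linInd _ _ fun j k => ?_⟩
  rw [hΓ] at hβ
  have hsum : ∑ i, β i * lamPos lam i = ∑ i, β i * lamNeg lam i := by
    have hz : ∑ i, lam i * (β i : ℤ) = 0 := by exact_mod_cast hβ
    zify
    rw [← sub_eq_zero, ← Finset.sum_sub_distrib, ← hz]
    refine Finset.sum_congr rfl fun i _ => ?_
    have : ((lamPos lam i : ℕ) : ℤ) - (lamNeg lam i : ℕ) = lam i := by
      simp only [lamPos, lamNeg]
      omega
    rw [← this]
    ring
  have hd : evalAt β (Xpow (lamPos lam) - Xpow (lamNeg lam)) = 0 := by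
    rw [evalAt_eq, map_sub, ← evalAt_eq, ← evalAt_eq, evalAt_Xpow, evalAt_Xpow, hsum, sub_self]
  obtain ⟨r, hr⟩ := h1 j k
  have h2 : evalAt β (SE E j * SE E' k - SE E' j * SE E k) = 0 := by
    rw [hr, evalAt_eq, map_mul, ← evalAt_eq, hd, zero_mul]
  rw [evalAt_eq, map_sub, map_mul, map_mul, sub_eq_zero] at h2
  simp only [SEvec, ← map_mul]
  exact congrArg _ h2

end WordEquations
end

section
/- Let p ∈ ℤ[X₁,…,Xₙ] have a factorization p = (X^{λ₀^{(1)}} − X^{λ₁^{(1)}})(X^{λ₀^{(2)}} − X^{λ₁^{(2)}})⋯(X^{λ₀^{(k)}} − X^{λ₁^{(k)}}) · Σ_{j∈J} e_j X^{α_j}, where the polynomials X^{λ₀^{(i)}} − X^{λ₁^{(i)}} are pairwise distinct irreducible polynomials, all λ_b^{(i)} are nonzero elements of ℕ₀ⁿ, each e_j = ±1, and α_j ≠ α_{j'} whenever j, j' ∈ J satisfy e_j ≠ e_{j'}. Then p contains at least k+1 minimal monomials. -/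
open scoped BigOperators

namespace WordEquations

section aux

open MvPolynomial

def toQ {n : ℕ} (β : Fin n →₀ ℕ) : Fin n → ℚ := fun i => (β i : ℚ)

lemma toQ_add {n : ℕ} (a b : Fin n →₀ ℕ) : toQ (a + b) = toQ a + toQ b := by
  ext i; simp [toQ]

lemma toQ_inj {n : ℕ} {a b : Fin n →₀ ℕ} (h : toQ a = toQ b) : a = b := by
  ext i
  have := congrFun h i
  simpa [toQ] using this

def IsMn {n : ℕ} (z : Fin n → ℚ) (p : MvPolynomial (Fin n) ℤ) (β : Fin n →₀ ℕ) : Prop :=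
  β ∈ p.support ∧ ∀ β' ∈ p.support, z ⬝ᵥ toQ β ≤ z ⬝ᵥ toQ β'

lemma exists_IsMn {n : ℕ} (z : Fin n → ℚ) {p : MvPolynomial (Fin n) ℤ} (hp : p ≠ 0) :
    ∃ β, IsMn z p β := by
  obtain ⟨β, h1, h2⟩ := p.support.exists_min_image (fun β => z ⬝ᵥ toQ β)
    (MvPolynomial.support_nonempty.2 hp)
  exact ⟨β, h1, h2⟩

lemma minl_mul {n : ℕ} {z : Fin n → ℚ} {a b : Fin n →₀ ℕ} (h : z ⬝ᵥ toQ b < z ⬝ᵥ toQ a)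
    {q : MvPolynomial (Fin n) ℤ} {β : Fin n →₀ ℕ}
    (hβ : IsMn z ((monomial a 1 - monomial b 1) * q) β) : ∃ γ, β = b + γ ∧ IsMn z q γ := by
  have hq : q ≠ 0 := by
    rintro rfl
    simpa using hβ.1
  obtain ⟨γ0, hγ0, hmin⟩ := exists_IsMn z hq
  have key : b + γ0 ∈ ((monomial a 1 - monomial b 1) * q).support := by
    rw [mem_support_iff, sub_mul, coeff_sub, coeff_monomial_mul, coeff_monomial_mul']
    split_ifs with hab
    · have : coeff (b + γ0 - a) q = 0 := by
        by_contra hne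
        have h1 := hmin _ (mem_support_iff.2 hne)
        have h2 : toQ (b + γ0) = toQ a + toQ (b + γ0 - a) := by
          rw [← toQ_add, add_tsub_cancel_of_le hab]
        have h3 := congrArg (fun v => z ⬝ᵥ v) h2
        simp only [toQ_add, dotProduct_add] at h3
        linarith
      rw [this]
      simpa using hγ0
    · simpa using hγ0
  have h1 := hβ.2 _ key
  have h2 := hβ.1
  rw [mem_support_iff, sub_mul, coeff_sub, coeff_monomial_mul', coeff_monomial_mul'] at h2
  rw [toQ_add, dotProduct_add] at h1
  have ha : ∀ (hab : a ≤ β), coeff (β - a) q = 0 := by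
    intro hab
    by_contra hne
    have h1 := hmin _ (mem_support_iff.2 hne)
    have h2 : toQ β = toQ a + toQ (β - a) := by
      rw [← toQ_add, add_tsub_cancel_of_le hab]
    have h3 := congrArg (fun v => z ⬝ᵥ v) h2
    simp only [dotProduct_add] at h3
    linarith
  have hb : b ≤ β ∧ coeff (β - b) q ≠ 0 := by
    by_contra hcon
    apply h2
    split_ifs with c1 c2 c2 <;> simp_all
  refine ⟨β - b, (add_tsub_cancel_of_le hb.1).symm, mem_support_iff.2 hb.2, fun γ hγ => ?_⟩
  have h2 : toQ β = toQ b + toQ (β - b) := by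
    rw [← toQ_add, add_tsub_cancel_of_le hb.1]
  have h3 := congrArg (fun v => z ⬝ᵥ v) h2
  simp only [dotProduct_add] at h3
  have := hmin _ hγ
  linarith

lemma no_both {n : ℕ} {z z' : Fin n → ℚ} {a b : Fin n →₀ ℕ} (h : z ⬝ᵥ toQ b < z ⬝ᵥ toQ a)
    (h' : z' ⬝ᵥ toQ a < z' ⬝ᵥ toQ b)
    {q : MvPolynomial (Fin n) ℤ} {β : Fin n →₀ ℕ}
    (hβ : IsMn z ((monomial a 1 - monomial b 1) * q) β)
    (hβ' : IsMn z' ((monomial a 1 - monomial b 1) * q) β) : False := by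
  obtain ⟨γ, rfl, hγ⟩ := minl_mul h hβ
  have e : (monomial a (1:ℤ) - monomial b 1) * q = (monomial b 1 - monomial a 1) * (-q) := by ring
  rw [e] at hβ'
  obtain ⟨γ', e', hγ'⟩ := minl_mul h' hβ'
  have h1 := hγ.2 γ' (by simpa using hγ'.1)
  have h2 := congrArg (fun v => z ⬝ᵥ toQ v) e'
  simp only [toQ_add, dotProduct_add] at h2
  linarith

/-- univariate lemma -/
lemma card_supp_of_dvd (m : ℕ) : ∀ (F : Polynomial ℤ), F ≠ 0 → (Polynomial.X - 1) ^ m ∣ F →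
    m + 1 ≤ F.support.card := by
  induction m with
  | zero =>
    intro F hF _
    have := Finset.card_pos.2 (Polynomial.support_nonempty.2 hF)
    omega
  | succ m ih =>
    intro F hF hd
    obtain ⟨G, hG, hG0⟩ : ∃ G : Polynomial ℤ, F = Polynomial.X ^ F.natTrailingDegree * G ∧
        G.coeff 0 ≠ 0 := by
      have : Polynomial.X ^ F.natTrailingDegree ∣ F := by
        rw [Polynomial.X_pow_dvd_iff]
        intro d hd
        exact Polynomial.coeff_eq_zero_of_lt_natTrailingDegree hd
      obtain ⟨G, hG⟩ := this
      refine ⟨G, hG, fun h => ?_⟩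
      have h1 : F.coeff F.natTrailingDegree = G.coeff 0 := by
        conv_lhs => rw [hG]
        rw [Polynomial.coeff_X_pow_mul']
        simp [← hG]
      have h2 : F.trailingCoeff ≠ 0 := by simpa using hF
      exact h2 (by rw [Polynomial.trailingCoeff, h1, h])
    have hcop : IsCoprime ((Polynomial.X - 1 : Polynomial ℤ) ^ (m+1))
        (Polynomial.X ^ F.natTrailingDegree) := by
      apply IsCoprime.pow
      exact ⟨-1, 1, by ring⟩
    have hdG : (Polynomial.X - 1 : Polynomial ℤ) ^ (m+1) ∣ G := by
      rw [hG] at hd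
      exact hcop.dvd_of_dvd_mul_left (by simpa [← hG] using hd)
    have hcard : F.support.card = G.support.card := by
      rw [hG]
      set N := F.natTrailingDegree
      symm
      apply Finset.card_bij (fun i _ => i + N)
      · intro i hi
        simpa [Polynomial.coeff_X_pow_mul] using hi
      · intro i _ j _ h; simpa using h
      · intro j hj
        rw [Polynomial.mem_support_iff, Polynomial.coeff_X_pow_mul'] at hj
        split_ifs at hj with hle
        · exact ⟨j - N, by simpa using hj, by omega⟩
        · exact absurd rfl hj
    have hGne : G ≠ 0 := by rintro rfl; simp at hG0
    have hdd : (Polynomial.X - 1 : Polynomial ℤ) ^ m ∣ Polynomial.derivative G := by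
      obtain ⟨H, rfl⟩ := hdG
      rw [Polynomial.derivative_mul, Polynomial.derivative_pow]
      refine dvd_add ?_ ?_
      · simp only [Nat.add_sub_cancel]
        exact ⟨Polynomial.C ((m + 1 : ℕ) : ℤ) * Polynomial.derivative (Polynomial.X - 1) * H, by
            ring⟩
      · exact (pow_dvd_pow _ (Nat.le_succ m)).trans (dvd_mul_right _ _)
    have hne : Polynomial.derivative G ≠ 0 := by
      intro h0
      have h1 := Polynomial.derivative_eq_zero.1 h0
      rw [Polynomial.eq_C_of_natDegree_eq_zero h1] at hdG hGne
      have h3 : (Polynomial.X - 1 : Polynomial ℤ) ∣ Polynomial.C (G.coeff 0) :=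
        (dvd_pow_self _ (Nat.succ_ne_zero m)).trans hdG
      obtain ⟨H, hH⟩ := h3
      have := congrArg (Polynomial.eval 1) hH
      simp at this
      exact hG0 this
    have h4 := ih _ hne hdd
    have h5 : (Polynomial.derivative G).support.card + 1 ≤ G.support.card := by
      have h0 : (0:ℕ) ∈ G.support := by simpa using hG0
      rw [← Finset.card_erase_add_one h0]
      gcongr ?_ + 1
      apply Finset.card_le_card_of_injOn (fun i => i + 1)
      · intro i hi
        simp only [Finset.mem_coe, Polynomial.mem_support_iff, Polynomial.coeff_derivative] at hi
        simp only [Finset.coe_erase, Set.mem_sdiff, Finset.mem_coe, Polynomial.mem_support_iff]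
        refine ⟨fun h => ?_, by simp⟩
        exact hi (by rw [h]; simp)
      · intro i _ j _ h; simpa using h
    omega

lemma exists_generic {n : ℕ} (d : Fin n → ℚ) (z0 : Fin n → ℚ) (h0 : ∀ i, 0 < z0 i)
    (hd : z0 ⬝ᵥ d = 0) (S : Finset (Fin n → ℚ)) (hS : ∀ v ∈ S, v ∉ Submodule.span ℚ {d}) :
    ∃ z : Fin n → ℚ, (∀ i, 0 < z i) ∧ z ⬝ᵥ d = 0 ∧ ∀ v ∈ S, z ⬝ᵥ v ≠ 0 := by
  classical
  induction S using Finset.induction_on with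
  | empty => exact ⟨z0, h0, hd, by simp⟩
  | insert v S hv ih =>
    obtain ⟨z, hz, hzd, hzS⟩ := ih (fun v hv => hS v (Finset.mem_insert_of_mem hv))
    obtain ⟨u, hud, huv⟩ : ∃ u : Fin n → ℚ, u ⬝ᵥ d = 0 ∧ u ⬝ᵥ v ≠ 0 := by
      have hvd := hS v (Finset.mem_insert_self _ _)
      have hort : (v - ((v ⬝ᵥ d) / (d ⬝ᵥ d)) • d) ⬝ᵥ d = 0 := by
        rw [sub_dotProduct, smul_dotProduct, smul_eq_mul]
        by_cases hdd : d ⬝ᵥ d = 0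
        · rw [dotProduct_self_eq_zero.1 hdd]; simp
        · field_simp; ring
      refine ⟨v - ((v ⬝ᵥ d) / (d ⬝ᵥ d)) • d, hort, ?_⟩
      set u := v - ((v ⬝ᵥ d) / (d ⬝ᵥ d)) • d with hu
      have hv' : v = u + ((v ⬝ᵥ d) / (d ⬝ᵥ d)) • d := by rw [hu]; simp
      intro hc
      rw [hv', dotProduct_add, dotProduct_smul, hort] at hc
      simp only [smul_zero, add_zero] at hc
      have := dotProduct_self_eq_zero.1 hc
      rw [this, zero_add] at hv'
      exact hvd (Submodule.mem_span_singleton.2 ⟨_, hv'.symm⟩)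
    have ev : ∀ᶠ t : ℚ in nhdsWithin 0 (Set.Ioi 0),
        (∀ i, 0 < z i + t * u i) ∧ ∀ w ∈ insert v S, z ⬝ᵥ w + t * (u ⬝ᵥ w) ≠ 0 := by
      have hcont : ∀ x y : ℚ, Filter.Tendsto (fun t : ℚ => x + t * y)
          (nhdsWithin 0 (Set.Ioi 0)) (nhds x) := by
        intro x y
        have : Continuous (fun t : ℚ => x + t * y) := by fun_prop
        have h := (this.tendsto 0).mono_left (nhdsWithin_le_nhds (s := Set.Ioi (0:ℚ)))
        simpa using h
      refine Filter.Eventually.and ?_ ?_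
      · rw [Filter.eventually_all]
        intro i
        exact (hcont _ _).eventually (lt_mem_nhds (hz i))
      · rw [Filter.eventually_all_finset]
        intro w hw
        by_cases hzw : z ⬝ᵥ w = 0
        · have hwv : w = v := by
            rcases Finset.mem_insert.1 hw with h | h
            · exact h
            · exact absurd hzw (hzS w h)
          subst hwv
          filter_upwards [self_mem_nhdsWithin] with t ht
          rw [hzw, zero_add]
          exact mul_ne_zero (ne_of_gt ht) huv
        · exact (hcont _ _).eventually (isOpen_ne.mem_nhds hzw)
    obtain ⟨t, ht1, ht2⟩ := ev.exists
    refine ⟨z + t • u, by simpa using ht1, ?_, ?_⟩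
    · rw [add_dotProduct, smul_dotProduct, hzd, hud]; simp
    · intro w hw
      rw [add_dotProduct, smul_dotProduct]
      exact ht2 w hw

lemma exists_base {n : ℕ} (d : Fin n → ℚ) (i j : Fin n) (hi : 0 < d i) (hj : d j < 0) :
    ∃ z : Fin n → ℚ, (∀ i, 0 < z i) ∧ z ⬝ᵥ d = 0 := by
  set P := ∑ i, max (d i) 0 with hP
  set N := ∑ i, max (- d i) 0 with hN
  have hPp : 0 < P := Finset.sum_pos' (fun _ _ => le_max_right _ _) ⟨i, Finset.mem_univ _, by simp [hi]⟩
  have hNp : 0 < N := Finset.sum_pos' (fun _ _ => le_max_right _ _) ⟨j, Finset.mem_univ _, by simp [hj]⟩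
  refine ⟨fun l => if 0 < d l then N else P, fun l => by dsimp only; split_ifs <;> assumption, ?_⟩
  have : ∀ l, (if 0 < d l then N else P) * d l = N * max (d l) 0 - P * max (- d l) 0 := by
    intro l
    split_ifs with h
    · rw [max_eq_left h.le, max_eq_right (by linarith)]; ring
    · rw [max_eq_right (by linarith), max_eq_left (by linarith)]; ring
  simp only [dotProduct, this, Finset.sum_sub_distrib, ← Finset.mul_sum, ← hP, ← hN]
  ring

lemma weight_eq {n : ℕ} (z : Fin n → ℚ) (β : Fin n →₀ ℕ) :
    Finsupp.weight z β = z ⬝ᵥ toQ β := by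
  rw [Finsupp.weight_apply, Finsupp.sum_fintype _ _ (by simp)]
  simp [dotProduct, toQ, mul_comm]

lemma whc_mul {n : ℕ} (z : Fin n → ℚ) (a : Fin n →₀ ℕ) (μ : ℚ) (q : MvPolynomial (Fin n) ℤ) :
    weightedHomogeneousComponent z μ (monomial a 1 * q) =
      monomial a 1 * weightedHomogeneousComponent z (μ - z ⬝ᵥ toQ a) q := by
  classical
  ext β
  rw [coeff_weightedHomogeneousComponent, coeff_monomial_mul', coeff_monomial_mul',
    coeff_weightedHomogeneousComponent, weight_eq, weight_eq]
  by_cases h : a ≤ β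
  · have h2 : toQ β = toQ a + toQ (β - a) := by
      rw [← toQ_add, add_tsub_cancel_of_le h]
    have h3 : z ⬝ᵥ toQ (β - a) = z ⬝ᵥ toQ β - z ⬝ᵥ toQ a := by
      rw [h2, dotProduct_add]; ring
    simp [h, h3]
  · simp [h]

lemma whc_prod {n : ℕ} {ι : Type*} (z : Fin n → ℚ) (s : Finset ι) (a b : ι → Fin n →₀ ℕ)
    (hs : ∀ i ∈ s, z ⬝ᵥ toQ (a i) = z ⬝ᵥ toQ (b i)) :
    ∀ (μ : ℚ) (r : MvPolynomial (Fin n) ℤ),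
    ∃ r', weightedHomogeneousComponent z μ
      ((∏ i ∈ s, (monomial (a i) (1:ℤ) - monomial (b i) 1)) * r) =
      (∏ i ∈ s, (monomial (a i) (1:ℤ) - monomial (b i) 1)) * r' := by
  classical
  induction s using Finset.induction_on with
  | empty => intro μ r; exact ⟨weightedHomogeneousComponent z μ r, by simp⟩
  | insert i s hi ih =>
    intro μ r
    obtain ⟨r', hr'⟩ := ih (fun i hi => hs i (Finset.mem_insert_of_mem hi))
      (μ - z ⬝ᵥ toQ (a i)) r
    refine ⟨r', ?_⟩
    rw [Finset.prod_insert hi, mul_assoc, sub_mul, map_sub, whc_mul, whc_mul,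
      ← hs i (Finset.mem_insert_self _ _), ← sub_mul, hr', mul_assoc]

open Classical in
lemma face_card {n : ℕ} {ι : Type*} (z : Fin n → ℚ) (s : Finset ι) (a b : ι → Fin n →₀ ℕ)
    (hs : ∀ i ∈ s, z ⬝ᵥ toQ (a i) = z ⬝ᵥ toQ (b i)) (p r : MvPolynomial (Fin n) ℤ)
    (hpr : p = (∏ i ∈ s, (monomial (a i) (1:ℤ) - monomial (b i) 1)) * r) (hp : p ≠ 0)
    (i0 : Fin n) (hline : ∀ β β', IsMn z p β → IsMn z p β' → β i0 = β' i0 → β = β') :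
    s.card + 1 ≤ (p.support.filter (IsMn z p)).card := by
  obtain ⟨β0, hβ0⟩ := exists_IsMn z hp
  set μ := z ⬝ᵥ toQ β0 with hμ
  set F := weightedHomogeneousComponent z μ p with hF
  have hcoef : ∀ β, coeff β F = if z ⬝ᵥ toQ β = μ then coeff β p else 0 := by
    intro β
    rw [hF, coeff_weightedHomogeneousComponent, weight_eq]
  have hsupp : ∀ β, β ∈ F.support ↔ IsMn z p β := by
    intro β
    rw [mem_support_iff, hcoef]
    constructor
    · intro h
      split_ifs at h with h1
      · exact ⟨mem_support_iff.2 h, fun β' hβ' => by rw [h1]; exact hβ0.2 _ hβ'⟩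
      · exact absurd rfl h
    · intro h
      rw [if_pos (le_antisymm (h.2 _ hβ0.1) (hβ0.2 _ h.1))]
      exact mem_support_iff.1 h.1
  have hfs : p.support.filter (IsMn z p) = F.support := by
    ext β
    rw [hsupp, Finset.mem_filter]
    exact ⟨fun h => h.2, fun h => ⟨h.1, h⟩⟩
  rw [hfs]
  obtain ⟨r', hr'⟩ := whc_prod z s a b hs μ r
  rw [← hpr, ← hF] at hr'
  let g : Fin n → Polynomial ℤ := fun j => if j = i0 then Polynomial.X else 1
  have hmon : ∀ (β : Fin n →₀ ℕ) (c : ℤ), aeval g (monomial β c) = Polynomial.monomial (β i0) c := by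
    intro β c
    rw [aeval_monomial, Finsupp.prod_fintype _ _ (by simp)]
    simp only [g, ite_pow, one_pow, Finset.prod_ite_eq', Finset.mem_univ, if_true]
    rw [← Polynomial.C_mul_X_pow_eq_monomial]; rfl
  have hφ : aeval g F = ∑ β ∈ F.support, Polynomial.monomial (β i0) (coeff β F) := by
    conv_lhs => rw [F.as_sum]
    rw [map_sum]
    exact Finset.sum_congr rfl fun β _ => hmon _ _
  have hφc : (aeval g F).coeff (β0 i0) = coeff β0 F := by
    rw [hφ, Polynomial.finsetSum_coeff, Finset.sum_eq_single β0]
    · simp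
    · intro β hβ hne
      rw [Polynomial.coeff_monomial, if_neg]
      intro h
      exact hne (hline _ _ ((hsupp _).1 hβ) hβ0 h)
    · intro h; exact absurd ((hsupp _).2 hβ0) h
  have hne : aeval g F ≠ 0 := by
    intro h
    rw [h] at hφc
    exact mem_support_iff.1 ((hsupp _).2 hβ0) hφc.symm
  have hdvd : (Polynomial.X - 1 : Polynomial ℤ) ^ s.card ∣ aeval g F := by
    rw [hr', map_mul, map_prod]
    refine Dvd.dvd.mul_right ?_ _
    rw [← Finset.prod_const]
    apply Finset.prod_dvd_prod_of_dvd
    intro i _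
    rw [map_sub, hmon, hmon, ← Polynomial.C_1, Polynomial.dvd_iff_isRoot]
    simp
  refine (card_supp_of_dvd _ _ hne hdvd).trans ?_
  calc _ ≤ (F.support.image (fun β => β i0)).card := by
        apply Finset.card_le_card
        intro j hj
        rw [Polynomial.mem_support_iff, hφ, Polynomial.finsetSum_coeff] at hj
        obtain ⟨β, hβ, hb⟩ := Finset.exists_ne_zero_of_sum_ne_zero hj
        rw [Polynomial.coeff_monomial] at hb
        refine Finset.mem_image.2 ⟨β, hβ, ?_⟩
        by_contra h
        exact hb (if_neg h)
    _ ≤ _ := Finset.card_image_le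

lemma combi {T A : Type*} [Fintype T] [DecidableEq A] (U : Finset A) (hU : U.Nonempty)
    (E : T → Finset A) (hEU : ∀ c, E c ⊆ U) (o : T → A) (ho : ∀ c, o c ∈ E c)
    (r : T → A → A) (hr : ∀ c, ∀ β ∈ E c, r c β = β)
    (hconst : ∀ c c', c ≠ c' → ∃ x, ∀ β ∈ E c', r c β = x) :
    1 + ∑ c, ((E c).card - 1) ≤ U.card := by
  classical
  let I := Option (Σ c, {e // e ∈ (E c).erase (o c)})
  let f : (I → ℚ) →ₗ[ℚ] (U → ℚ) :=
    { toFun := fun v u => v none + ∑ c, if h : r c u ∈ (E c).erase (o c) then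
        v (some ⟨c, r c u, h⟩) else 0
      map_add' := by
        intro v w
        ext u
        simp only [Pi.add_apply]
        rw [add_add_add_comm, ← Finset.sum_add_distrib]
        congr 1
        apply Finset.sum_congr rfl
        intro c _
        split_ifs <;> simp
      map_smul' := by
        intro t v
        ext u
        simp only [Pi.smul_apply, smul_eq_mul, RingHom.id_apply]
        rw [mul_add, Finset.mul_sum]
        congr 1
        apply Finset.sum_congr rfl
        intro c _
        split_ifs <;> simp }
  have hf : Function.Injective f := by
    rw [injective_iff_map_eq_zero]
    intro v hv
    have hv' : ∀ u : U, v none + ∑ c, (if h : r c u ∈ (E c).erase (o c) then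
        v (some ⟨c, r c u, h⟩) else 0) = 0 := fun u => congrFun hv u
    have hsome : ∀ x, v (some x) = 0 := by
      rintro ⟨c, e, he⟩
      have heE := Finset.mem_of_mem_erase he
      have h1 := hv' ⟨e, hEU c heE⟩
      have h2 := hv' ⟨o c, hEU c (ho c)⟩
      rw [← Finset.add_sum_erase _ _ (Finset.mem_univ c)] at h1 h2
      have h3 : ∀ c' ∈ Finset.univ.erase c,
          (if h : r c' e ∈ (E c').erase (o c') then v (some ⟨c', r c' e, h⟩) else 0) =
          (if h : r c' (o c) ∈ (E c').erase (o c') then v (some ⟨c', r c' (o c), h⟩) else 0) := by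
        intro c' hc'
        obtain ⟨x, hx⟩ := hconst c' c (Finset.ne_of_mem_erase hc')
        have hxx : r c' e = r c' (o c) := by rw [hx _ heE, hx _ (ho c)]
        simp only [hxx]
      rw [Finset.sum_congr rfl h3] at h1
      simp only [hr c e heE, hr c _ (ho c)] at h1 h2
      rw [dif_pos he] at h1
      rw [dif_neg (Finset.notMem_erase _ _)] at h2
      linarith
    have hnone : v none = 0 := by
      obtain ⟨u, hu⟩ := hU
      have := hv' ⟨u, hu⟩
      simpa [hsome] using this
    ext x
    cases x with
    | none => exact hnone
    | some x => exact hsome x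
  have := LinearMap.finrank_le_finrank_of_injective hf
  rw [Module.finrank_fintype_fun_eq_card, Module.finrank_fintype_fun_eq_card] at this
  simp only [I, Fintype.card_option, Fintype.card_sigma, Fintype.card_coe] at this
  simp only [Finset.card_erase_of_mem (ho _)] at this
  omega

lemma not_le_of_irr {n : ℕ} {a b : Fin n →₀ ℕ} (ha : a ≠ 0)
    (h : Irreducible (monomial a (1:ℤ) - monomial b 1)) : ¬ a ≤ b := by
  intro hab
  have e : (monomial a (1:ℤ) - monomial b 1) = monomial a 1 * (1 - monomial (b - a) 1) := by
    rw [mul_sub, mul_one, monomial_mul, add_tsub_cancel_of_le hab, one_mul]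
  rcases h.isUnit_or_isUnit e with hu | hu
  · have := hu.map (eval (fun _ => (0:ℤ)))
    rw [eval_monomial] at this
    obtain ⟨i, hi⟩ := Finsupp.ne_iff.1 ha
    have hz : a.prod (fun n e => (0:ℤ) ^ e) = 0 := by
      apply Finset.prod_eq_zero (i := i)
      · simpa using hi
      · exact zero_pow hi
    simp [hz] at this
  · have := hu.map (eval (fun _ => (1:ℤ)))
    simp [eval_monomial] at this

lemma mem_minimalSupport_of_IsMn {n : ℕ} {z : Fin n → ℚ} (hz : ∀ i, 0 < z i)
    {p : MvPolynomial (Fin n) ℤ} {β : Fin n →₀ ℕ} (h : IsMn z p β) : β ∈ minimalSupport p := by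
  rw [minimalSupport, Finset.mem_filter]
  refine ⟨h.1, fun β' hβ' hle => ?_⟩
  by_contra hne
  obtain ⟨i, hi⟩ := Finsupp.ne_iff.1 hne
  have h1 := h.2 _ hβ'
  have h2 : z ⬝ᵥ toQ β' < z ⬝ᵥ toQ β := by
    apply Finset.sum_lt_sum
    · intro j _
      exact mul_le_mul_of_nonneg_left (Nat.cast_le.2 (hle j)) (hz j).le
    · exact ⟨i, Finset.mem_univ _,
        mul_lt_mul_of_pos_left (Nat.cast_lt.2 (lt_of_le_of_ne (hle i) hi)) (hz i)⟩
  linarith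

lemma main_aux {n k : ℕ} (a b : Fin k → Fin n →₀ ℕ) (hab : ∀ i, ¬ a i ≤ b i)
    (hba : ∀ i, ¬ b i ≤ a i) (p q : MvPolynomial (Fin n) ℤ) (hp0 : p ≠ 0)
    (hp : p = (∏ i, (monomial (a i) (1:ℤ) - monomial (b i) 1)) * q) :
    k + 1 ≤ (minimalSupport p).card := by
  classical
  let d : Fin k → Fin n → ℚ := fun i => toQ (a i) - toQ (b i)
  let cls : Fin k → Submodule ℚ (Fin n → ℚ) := fun i => Submodule.span ℚ {d i}
  let T := Set.range cls
  let rep : T → Fin k := fun c => c.2.choose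
  have hrep : ∀ c : T, cls (rep c) = c := fun c => c.2.choose_spec
  have hgen : ∀ c : T, ∃ z : Fin n → ℚ, (∀ i, 0 < z i) ∧ z ⬝ᵥ d (rep c) = 0 ∧
      ∀ v ∈ (((p.support ×ˢ p.support).image (fun x => toQ x.1 - toQ x.2)) ∪
        Finset.univ.image d).filter (fun v => v ∉ Submodule.span ℚ {d (rep c)}),
        z ⬝ᵥ v ≠ 0 := by
    intro c
    obtain ⟨i, hi⟩ := not_forall.1 (hab (rep c))
    obtain ⟨j, hj⟩ := not_forall.1 (hba (rep c))
    obtain ⟨z0, h1, h2⟩ := exists_base (d (rep c)) i j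
      (by simp only [d, toQ, Pi.sub_apply, sub_pos, Nat.cast_lt]; omega)
      (by simp only [d, toQ, Pi.sub_apply, sub_neg, Nat.cast_lt]; omega)
    exact exists_generic _ z0 h1 h2 _ (fun v hv => (Finset.mem_filter.1 hv).2)
  choose z hzpos hzd hzgen using hgen
  have hdd : ∀ c, ∃ i0, d (rep c) i0 ≠ 0 := by
    intro c
    obtain ⟨i, hi⟩ := not_forall.1 (hab (rep c))
    refine ⟨i, ne_of_gt ?_⟩
    simp only [d, toQ, Pi.sub_apply, sub_pos, Nat.cast_lt]; omega
  -- all factors of the class vanish at `z c`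
  have hzcls : ∀ (c : T) i, cls i = c → z c ⬝ᵥ toQ (a i) = z c ⬝ᵥ toQ (b i) := by
    intro c i hi
    have : d i ∈ Submodule.span ℚ {d (rep c)} := by
      have h1 : d i ∈ cls i := Submodule.mem_span_singleton_self _
      rwa [hi, ← hrep c] at h1
    obtain ⟨t, ht⟩ := Submodule.mem_span_singleton.1 this
    have h2 : z c ⬝ᵥ d i = 0 := by rw [← ht, dotProduct_smul, hzd]; simp
    simp only [d, dotProduct_sub] at h2
    linarith
  have hcross : ∀ c c' : T, c ≠ c' → z c' ⬝ᵥ d (rep c) ≠ 0 := by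
    intro c c' hne
    apply hzgen c'
    refine Finset.mem_filter.2 ⟨Finset.mem_union_right _
      (Finset.mem_image_of_mem _ (Finset.mem_univ _)), fun hmem => hne ?_⟩
    apply Subtype.ext
    rw [← hrep c, ← hrep c']
    obtain ⟨t, ht⟩ := Submodule.mem_span_singleton.1 hmem
    have ht0 : t ≠ 0 := by
      rintro rfl
      obtain ⟨i, hi⟩ := hdd c
      exact hi (by rw [← ht]; simp)
    change Submodule.span ℚ {d (rep c)} = Submodule.span ℚ {d (rep c')}
    rw [← ht]
    exact Submodule.span_singleton_smul_eq (IsUnit.mk0 t ht0) _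
  have hline : ∀ c β β', IsMn (z c) p β → IsMn (z c) p β' →
      ∃ t : ℚ, toQ β - toQ β' = t • d (rep c) := by
    intro c β β' h h'
    by_contra hcon
    refine hzgen c (toQ β - toQ β') (Finset.mem_filter.2 ⟨Finset.mem_union_left _
      (Finset.mem_image.2 ⟨(β, β'), Finset.mem_product.2 ⟨h.1, h'.1⟩, rfl⟩), fun hmem => ?_⟩) ?_
    · obtain ⟨t, ht⟩ := Submodule.mem_span_singleton.1 hmem
      exact hcon ⟨t, ht.symm⟩
    · rw [dotProduct_sub]
      linarith [h.2 _ h'.1, h'.2 _ h.1]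
  let E : T → Finset (Fin n →₀ ℕ) := fun c => p.support.filter (IsMn (z c) p)
  have hE : ∀ c β, β ∈ E c ↔ IsMn (z c) p β := by
    intro c β
    rw [Finset.mem_filter]
    exact ⟨fun h => h.2, fun h => ⟨h.1, h⟩⟩
  have hEne : ∀ c, (E c).Nonempty := by
    intro c
    obtain ⟨β, hβ⟩ := exists_IsMn (z c) hp0
    exact ⟨β, (hE _ _).2 hβ⟩
  have hEcard : ∀ c : T, (Finset.univ.filter (fun i => cls i = c)).card + 1 ≤ (E c).card := by
    intro c
    obtain ⟨i0, hi0⟩ := hdd c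
    refine face_card (z c) (Finset.univ.filter (fun i => cls i = c)) a b
      (fun i hi => hzcls c i (Finset.mem_filter.1 hi).2) p
      ((∏ i ∈ Finset.univ.filter (fun i => ¬ cls i = c),
        (monomial (a i) (1:ℤ) - monomial (b i) 1)) * q) ?_ hp0 i0 ?_
    · rw [← mul_assoc, Finset.prod_filter_mul_prod_filter_not]
      exact hp
    · intro β β' h h' heq
      obtain ⟨t, ht⟩ := hline c β β' h h'
      have h1 := congrFun ht i0
      simp only [toQ, Pi.sub_apply, heq, sub_self, Pi.smul_apply, smul_eq_mul] at h1
      have ht0 : t = 0 := by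
        rcases mul_eq_zero.1 h1.symm with h | h
        · exact h
        · exact absurd h hi0
      rw [ht0, zero_smul, sub_eq_zero] at ht
      exact toQ_inj ht
  have hlo : ∀ c, ∃ x ∈ E c, ∀ y ∈ E c, d (rep c) ⬝ᵥ toQ x ≤ d (rep c) ⬝ᵥ toQ y :=
    fun c => (E c).exists_min_image _ (hEne c)
  have hhi : ∀ c, ∃ x ∈ E c, ∀ y ∈ E c, d (rep c) ⬝ᵥ toQ y ≤ d (rep c) ⬝ᵥ toQ x :=
    fun c => (E c).exists_max_image _ (hEne c)
  choose lo hloE hlom using hlo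
  choose hi hhiE hhim using hhi
  have hdpos : ∀ c, 0 < d (rep c) ⬝ᵥ d (rep c) := by
    intro c
    obtain ⟨i0, hi0⟩ := hdd c
    refine lt_of_le_of_ne (Finset.sum_nonneg fun i _ => mul_self_nonneg _) (fun h => hi0 ?_)
    rw [dotProduct_self_eq_zero.1 h.symm]; rfl
  have hloeq : ∀ c c' β, IsMn (z c) p β → IsMn (z c') p β → 0 < z c' ⬝ᵥ d (rep c) →
      β = lo c := by
    intro c c' β h h' hpos
    obtain ⟨t, ht⟩ := hline c (lo c) β ((hE _ _).1 (hloE c)) h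
    have h1 := h'.2 _ ((hE _ _).1 (hloE c)).1
    have h2 := hlom c β ((hE _ _).2 h)
    have h3 : z c' ⬝ᵥ toQ (lo c) - z c' ⬝ᵥ toQ β = t * (z c' ⬝ᵥ d (rep c)) := by
      rw [← dotProduct_sub, ht, dotProduct_smul]; rfl
    have h4 : d (rep c) ⬝ᵥ toQ (lo c) - d (rep c) ⬝ᵥ toQ β
        = t * (d (rep c) ⬝ᵥ d (rep c)) := by
      rw [← dotProduct_sub, ht, dotProduct_smul]; rfl
    have ht0 : t = 0 := by
      apply le_antisymm
      · by_contra hc; push Not at hc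
        have := mul_pos hc (hdpos c); linarith
      · by_contra hc; push Not at hc
        have := mul_neg_of_neg_of_pos hc hpos; linarith
    rw [ht0, zero_smul, sub_eq_zero] at ht
    exact (toQ_inj ht).symm
  have hhieq : ∀ c c' β, IsMn (z c) p β → IsMn (z c') p β → z c' ⬝ᵥ d (rep c) < 0 →
      β = hi c := by
    intro c c' β h h' hneg
    obtain ⟨t, ht⟩ := hline c (hi c) β ((hE _ _).1 (hhiE c)) h
    have h1 := h'.2 _ ((hE _ _).1 (hhiE c)).1
    have h2 := hhim c β ((hE _ _).2 h)
    have h3 : z c' ⬝ᵥ toQ (hi c) - z c' ⬝ᵥ toQ β = t * (z c' ⬝ᵥ d (rep c)) := by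
      rw [← dotProduct_sub, ht, dotProduct_smul]; rfl
    have h4 : d (rep c) ⬝ᵥ toQ (hi c) - d (rep c) ⬝ᵥ toQ β
        = t * (d (rep c) ⬝ᵥ d (rep c)) := by
      rw [← dotProduct_sub, ht, dotProduct_smul]; rfl
    have ht0 : t = 0 := by
      apply le_antisymm
      · by_contra hc; push Not at hc
        have := mul_neg_of_pos_of_neg hc hneg; linarith
      · by_contra hc; push Not at hc
        have := mul_neg_of_neg_of_pos hc (hdpos c); linarith
    rw [ht0, zero_smul, sub_eq_zero] at ht
    exact (toQ_inj ht).symm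
  have hUne : (minimalSupport p).Nonempty := by
    obtain ⟨β, hβ⟩ := exists_IsMn (fun _ => (1:ℚ)) hp0
    exact ⟨β, mem_minimalSupport_of_IsMn (fun _ => one_pos) hβ⟩
  have hcomb := combi (minimalSupport p) hUne E
    (fun c β hβ => mem_minimalSupport_of_IsMn (hzpos c) ((hE _ _).1 hβ)) lo hloE
    (fun c β => if β ∈ E c then β else
      if ∃ c', β ∈ E c' ∧ 0 < z c' ⬝ᵥ d (rep c) then lo c else hi c)
    (fun c β hβ => if_pos hβ) ?_
  · have hk : ∑ c : T, (Finset.univ.filter (fun i => cls i = c)).card = k := by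
      have h1 := Finset.card_eq_sum_card_fiberwise (f := Set.rangeFactorization cls)
        (s := Finset.univ) (t := Finset.univ) (by intro x _; simp)
      rw [Finset.card_univ, Fintype.card_fin] at h1
      conv_rhs => rw [h1]
      apply Finset.sum_congr rfl
      intro c _
      congr 1
      ext i
      simp [Set.rangeFactorization, Subtype.ext_iff]
    have hle : ∑ c : T, (Finset.univ.filter (fun i => cls i = c)).card ≤
        ∑ c, ((E c).card - 1) :=
      Finset.sum_le_sum fun c _ => by have := hEcard c; omega
    omega
  · intro c c' hne
    rcases lt_or_gt_of_ne (hcross c c' hne) with hneg | hpos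
    · refine ⟨hi c, fun β hβ => ?_⟩
      split_ifs with h1 h2
      · exact hhieq c c' β ((hE _ _).1 h1) ((hE _ _).1 hβ) hneg
      · exfalso
        obtain ⟨c'', h3, h4⟩ := h2
        have hf : p = (monomial (a (rep c)) (1:ℤ) - monomial (b (rep c)) 1) *
            ((∏ i ∈ Finset.univ.erase (rep c), (monomial (a i) (1:ℤ) - monomial (b i) 1)) * q) := by
          rw [← mul_assoc, Finset.mul_prod_erase _
            (fun i => monomial (a i) (1:ℤ) - monomial (b i) 1) (Finset.mem_univ _)]
          exact hp
        have m1 := (hE _ _).1 h3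
        have m2 := (hE _ _).1 hβ
        rw [hf] at m1 m2
        simp only [d, dotProduct_sub] at h4 hneg
        exact no_both (by linarith) (by linarith) m1 m2
      · rfl
    · refine ⟨lo c, fun β hβ => ?_⟩
      split_ifs with h1 h2
      · exact hloeq c c' β ((hE _ _).1 h1) ((hE _ _).1 hβ) hpos
      · rfl
      · exact absurd ⟨c', hβ, hpos⟩ h2

lemma Xpow_eq {n : ℕ} (α : Fin n → ℕ) :
    Xpow α = monomial (Finsupp.equivFunOnFinite.symm α) 1 := by
  rw [monomial_eq, Finsupp.prod_fintype _ _ (by simp)]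
  simp [Xpow]

end aux

/-- a polynomial of the form
`p = ∏ᵢ (X^{λ₀⁽ⁱ⁾} - X^{λ₁⁽ⁱ⁾}) · Σⱼ eⱼ X^{αⱼ}` as in the paper has at least `k + 1`
minimal monomials. -/
theorem minimal_monomials_of_factorization {n k m : ℕ} (hm : 0 < m)
    (l₀ l₁ : Fin k → Fin n → ℕ) (α : Fin m → Fin n → ℕ) (e : Fin m → ℤ)
    (he : ∀ j, e j = 1 ∨ e j = -1)
    (hα : ∀ j j', e j ≠ e j' → α j ≠ α j')
    (hirr : ∀ i, Irreducible (Xpow (l₀ i) - Xpow (l₁ i)))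
    (hdist : ∀ i i', i ≠ i' → Xpow (l₀ i) - Xpow (l₁ i) ≠ Xpow (l₀ i') - Xpow (l₁ i'))
    (hl₀ : ∀ i, l₀ i ≠ 0) (hl₁ : ∀ i, l₁ i ≠ 0)
    (p : MvPolynomial (Fin n) ℤ)
    (hp : p = (∏ i, (Xpow (l₀ i) - Xpow (l₁ i))) * ∑ j, MvPolynomial.C (e j) * Xpow (α j)) :
    k + 1 ≤ (minimalSupport p).card := by
  classical
  have hq : (∑ j, MvPolynomial.C (e j) * Xpow (α j)) ≠ 0 := by
    intro h
    have h1 := congrArg (MvPolynomial.coeff (Finsupp.equivFunOnFinite.symm (α ⟨0, hm⟩))) h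
    simp only [Xpow_eq, MvPolynomial.coeff_sum, MvPolynomial.coeff_C_mul,
      MvPolynomial.coeff_monomial, EmbeddingLike.apply_eq_iff_eq, MvPolynomial.coeff_zero] at h1
    have h2 : ∀ j, e j * (if α j = α ⟨0, hm⟩ then 1 else 0) =
        e ⟨0, hm⟩ * (if α j = α ⟨0, hm⟩ then 1 else 0) := by
      intro j
      split_ifs with hj
      · have : e j = e ⟨0, hm⟩ := by
          by_contra hne
          exact hα _ _ hne hj
        rw [this]
      · simp
    simp only [h2] at h1
    rw [← Finset.mul_sum] at h1
    rcases mul_eq_zero.1 h1 with h3 | h3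
    · rcases he ⟨0, hm⟩ with h4 | h4 <;> rw [h4] at h3 <;> norm_num at h3
    · have h4 : (0:ℤ) < ∑ j, (if α j = α ⟨0, hm⟩ then 1 else 0) :=
        Finset.sum_pos' (fun j _ => by split_ifs <;> norm_num)
          ⟨⟨0, hm⟩, Finset.mem_univ _, by simp⟩
      omega
  have hp0 : p ≠ 0 := by
    rw [hp]
    exact mul_ne_zero (Finset.prod_ne_zero_iff.2 fun i _ => (hirr i).ne_zero) hq
  have hne : ∀ v : Fin n → ℕ, v ≠ 0 → Finsupp.equivFunOnFinite.symm v ≠ 0 := by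
    intro v hv h
    apply hv
    ext i
    exact DFunLike.congr_fun h i
  simp only [Xpow_eq] at hirr
  refine main_aux (fun i => Finsupp.equivFunOnFinite.symm (l₀ i))
    (fun i => Finsupp.equivFunOnFinite.symm (l₁ i)) (fun i => ?_) (fun i => ?_) p
    (∑ j, MvPolynomial.C (e j) * Xpow (α j)) hp0
    (hp.trans (by simp only [Xpow_eq]))
  · exact not_le_of_irr (hne _ (hl₀ i)) (hirr i)
  · refine not_le_of_irr (hne _ (hl₁ i)) ?_
    have := (Associated.neg_right (Associated.refl _)).irreducible (hirr i)
    rwa [neg_sub] at this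

end WordEquations
end

section
/- Let E and E' be strongly independent word equations in n unknowns and let h₁,…,h_m be pairwise linearly nonequivalent solutions of rank n−1 of both E and E'. Then: (1) m ≤ |E| + |E'|; and (2) there exist indices k < ℓ ≤ n such that m ≤ 2(|E|_{x_k} + |E|_{x_ℓ}). -/
open scoped BigOperators

namespace WordEquations

/-! ### Fox derivatives of words -/

/-- The weighted Fox derivative of a word. -/
def fox {ι R : Type*} [DecidableEq ι] [CommRing R] (ψ : ι → R) (k : ι) : List ι → R
  | [] => 0
  | b :: w => (if b = k then 1 else 0) + ψ b * fox ψ k w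

theorem fox_map {ι R S : Type*} [DecidableEq ι] [CommRing R] [CommRing S] (f : R →+* S)
    (ψ : ι → R) (k : ι) (w : List ι) : f (fox ψ k w) = fox (fun i => f (ψ i)) k w := by
  induction w with
  | nil => simp [fox]
  | cons b w ih => simp only [fox, map_add, map_mul, ih]; split_ifs <;> simp

theorem fox_one {ι R : Type*} [DecidableEq ι] [CommRing R] (k : ι) (w : List ι) :
    fox (fun _ => (1 : R)) k w = (w.count k : R) := by
  induction w with
  | nil => simp [fox]
  | cons b w ih =>
    simp only [fox, ih, List.count_cons, beq_iff_eq]; split_ifs <;> push_cast <;> ring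

theorem fox_append {ι R : Type*} [DecidableEq ι] [CommRing R] (ψ : ι → R) (k : ι)
    (w w' : List ι) : fox ψ k (w ++ w') = fox ψ k w + (w.map ψ).prod * fox ψ k w' := by
  induction w with
  | nil => simp [fox]
  | cons b w ih => simp only [List.cons_append, fox, ih, List.map_cons, List.prod_cons]; ring

/-- The chain rule. -/
theorem fox_flatMap {ι κ R : Type*} [DecidableEq ι] [Fintype ι] [DecidableEq κ] [CommRing R]
    (ψ : κ → R) (h : ι → List κ) (a : κ) (w : List ι) :
    fox ψ a (w.flatMap h) =
      ∑ j, fox (fun i => ((h i).map ψ).prod) j w * fox ψ a (h j) := by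
  induction w with
  | nil => simp [fox]
  | cons b w ih =>
    simp only [List.flatMap_cons, fox_append, ih, fox, add_mul, Finset.sum_add_distrib, ite_mul,
      one_mul, zero_mul, Finset.sum_ite_eq, Finset.mem_univ, if_true, Finset.mul_sum, mul_assoc]

/-- The fundamental formula. -/
theorem fox_fund {ι R : Type*} [DecidableEq ι] [Fintype ι] [CommRing R]
    (ψ : ι → R) (w : List ι) :
    ∑ j, fox ψ j w * (ψ j - 1) = (w.map ψ).prod - 1 := by
  induction w with
  | nil => simp [fox]
  | cons b w ih =>
    simp only [fox, add_mul, Finset.sum_add_distrib, ite_mul, one_mul, zero_mul, Finset.sum_ite_eq,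
      Finset.mem_univ, if_true, mul_assoc, ← Finset.mul_sum, ih, List.map_cons, List.prod_cons]
    ring

open MvPolynomial in
/-- A word is determined by its (abelianized) Fox derivatives. -/
theorem fox_inj {κ : Type*} [DecidableEq κ] (w w' : List κ)
    (hw : ∀ a, fox (X : κ → MvPolynomial κ ℤ) a w = fox X a w') : w = w' := by
  have key : ∀ (a b : κ) (v : List κ), constantCoeff (fox (X : κ → MvPolynomial κ ℤ) a (b :: v))
      = if b = a then 1 else 0 := by
    intro a b v
    simp only [fox, map_add, map_mul, constantCoeff_X, zero_mul, add_zero]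
    split_ifs <;> simp
  induction w generalizing w' with
  | nil =>
    cases w' with
    | nil => rfl
    | cons c w' =>
      have := congrArg constantCoeff (hw c)
      rw [key] at this
      simp [fox] at this
  | cons b w ih =>
    cases w' with
    | nil =>
      have := congrArg constantCoeff (hw b)
      rw [key] at this
      simp [fox] at this
    | cons c w' =>
      have := congrArg constantCoeff (hw b)
      rw [key, key] at this
      have hbc : b = c := by
        by_contra hne
        have : ¬ c = b := fun e => hne e.symm
        simp_all
      subst hbc
      rw [ih w']
      intro a
      have h1 := hw a
      simp only [fox] at h1
      exact mul_left_cancel₀ (X_ne_zero b) (add_left_cancel h1)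

/-- Nonnegativity of Fox derivatives for weights zero or one. -/
theorem fox_nonneg {ι : Type*} [DecidableEq ι] (ψ : ι → ℤ) (hψ : ∀ i, 0 ≤ ψ i) (k : ι)
    (w : List ι) : 0 ≤ fox ψ k w := by
  induction w with
  | nil => simp [fox]
  | cons b w ih =>
    have := mul_nonneg (hψ b) ih
    simp only [fox]; split_ifs <;> omega

/-- The monomial attached to a word. -/
noncomputable abbrev mon {κ : Type*} (w : List κ) : MvPolynomial κ ℤ :=
  (w.map MvPolynomial.X).prod

theorem mon_ne_zero {κ : Type*} (w : List κ) : mon w ≠ 0 := by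
  unfold mon
  apply List.prod_ne_zero
  simp only [List.mem_map, not_exists, not_and]
  intro x _
  exact MvPolynomial.X_ne_zero x

theorem mon_const {κ : Type*} (w : List κ) :
    MvPolynomial.constantCoeff (mon w) = if w = [] then 1 else 0 := by
  cases w <;> simp [mon]

/-- If at most one unknown is erased by `g`, the `g`-images of the Fox derivatives determine
the word. -/
theorem fox_mon_inj {ι κ : Type*} [DecidableEq ι] [DecidableEq κ] (g : ι → List κ)
    (hg : ∀ i j, g i = [] → g j = [] → i = j) (u v : List ι)
    (huv : ∀ k, fox (fun i => mon (g i)) k u = fox (fun i => mon (g i)) k v) : u = v := by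
  set ψ : ι → ℤ := fun i => if g i = [] then 1 else 0 with hψ
  have hψ0 : ∀ i, 0 ≤ ψ i := by intro i; simp only [hψ]; split_ifs <;> simp
  have key : ∀ k w, MvPolynomial.constantCoeff (fox (fun i => mon (g i)) k w) = fox ψ k w := by
    intro k w
    rw [fox_map]; simp only [mon_const, hψ]
  have pos : ∀ c w, 0 < fox ψ c (c :: w) := by
    intro c w
    have := mul_nonneg (hψ0 c) (fox_nonneg ψ hψ0 c w)
    simp only [fox, if_true]; omega
  induction u generalizing v with
  | nil =>
    cases v with
    | nil => rfl
    | cons c v =>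
      have := congrArg MvPolynomial.constantCoeff (huv c)
      rw [key, key] at this
      have h1 := pos c v
      rw [← this] at h1
      simp [fox] at h1
  | cons b u ih =>
    cases v with
    | nil =>
      have := congrArg MvPolynomial.constantCoeff (huv b)
      rw [key, key] at this
      have h1 := pos b u
      rw [this] at h1
      simp [fox] at h1
    | cons c v =>
      have hbc : b = c := by
        by_contra hne
        have hne' : ¬ c = b := fun e => hne e.symm
        by_cases hb : g b = []
        · have hc : g c ≠ [] := fun hc => hne (hg _ _ hb hc)
          have := congrArg MvPolynomial.constantCoeff (huv b)
          rw [key, key] at this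
          have h1 := pos b u
          rw [this] at h1
          simp [fox, hne', hψ, hc] at h1
        · have := congrArg MvPolynomial.constantCoeff (huv c)
          rw [key, key] at this
          have h1 := pos c v
          rw [← this] at h1
          simp [fox, hne, hψ, hb] at h1
      subst hbc
      rw [ih v]
      intro a
      have h1 := huv a
      simp only [fox] at h1
      exact mul_left_cancel₀ (mon_ne_zero (g b)) (add_left_cancel h1)

/-! ### Linear algebra of `Γ_h` -/

section LinAlg
open Module

variable {r c : ℕ} {h : Fin (r + 1) → List (Fin c)}

theorem perp_space {n c : ℕ} {h : Fin n → List (Fin c)} {v : Fin n → ℚ}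
    (hv : ∀ a, gamVec h a ⬝ᵥ v = 0) {x : Fin n → ℚ} (hx : x ∈ GammaSpace h) : x ⬝ᵥ v = 0 := by
  unfold GammaSpace at hx
  induction hx using Submodule.span_induction with
  | mem x hx => obtain ⟨a, rfl⟩ := hx; exact hv a
  | zero => simp
  | add x y _ _ hx hy => rw [add_dotProduct, hx, hy, add_zero]
  | smul t x _ hx => rw [smul_dotProduct, hx, smul_zero]

theorem gamVec_mem {n c : ℕ} (h : Fin n → List (Fin c)) (a : Fin c) :
    gamVec h a ∈ GammaSpace h := Submodule.subset_span ⟨a, rfl⟩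

theorem mem_of_perp (hr : morphRank h = r) {v : Fin (r + 1) → ℚ} (hv0 : v ≠ 0)
    (hv : ∀ a, gamVec h a ⬝ᵥ v = 0) {x : Fin (r + 1) → ℚ} (hx : x ⬝ᵥ v = 0) :
    x ∈ GammaSpace h := by
  let f : (Fin (r + 1) → ℚ) →ₗ[ℚ] ℚ :=
    { toFun := fun x => x ⬝ᵥ v
      map_add' := fun x y => add_dotProduct x y v
      map_smul' := fun t x => smul_dotProduct t x v }
  have hle : GammaSpace h ≤ LinearMap.ker f := fun y hy => perp_space hv hy
  have hf : f ≠ 0 := by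
    intro hf
    apply hv0
    have : f v = 0 := by rw [hf]; rfl
    exact dotProduct_self_eq_zero.mp this
  have hsur : LinearMap.range f = ⊤ := LinearMap.range_eq_top.mpr (LinearMap.surjective hf)
  have hk := LinearMap.finrank_range_add_finrank_ker f
  rw [hsur] at hk
  simp at hk
  have : GammaSpace h = LinearMap.ker f := by
    apply Submodule.eq_of_le_of_finrank_le hle
    unfold morphRank at hr
    omega
  rw [this]
  exact hx

theorem exists_single_notMem (hr : morphRank h = r) :
    ∃ j, (Pi.single j 1 : Fin (r + 1) → ℚ) ∉ GammaSpace h := by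
  by_contra! hcon
  have : GammaSpace h = ⊤ := by
    rw [eq_top_iff]
    intro x _
    rw [pi_eq_sum_univ' x]
    refine Submodule.sum_mem _ fun i _ => Submodule.smul_mem _ _ ?_
    convert hcon i using 1
  unfold morphRank at hr
  rw [this] at hr
  simp at hr

theorem perp_eq_zero (hr : morphRank h = r) {j : Fin (r + 1)}
    (hj : (Pi.single j 1 : Fin (r + 1) → ℚ) ∉ GammaSpace h) {v : Fin (r + 1) → ℚ}
    (hv : ∀ a, gamVec h a ⬝ᵥ v = 0) (hvj : v j = 0) : v = 0 := by
  by_contra hne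
  exact hj (mem_of_perp hr hne hv (by simp [hvj]))

theorem exists_lambda (hr : morphRank h = r) :
    ∃ lam : Fin (r + 1) → ℚ, lam ≠ 0 ∧ (∀ a, gamVec h a ⬝ᵥ lam = 0) ∧
      ∀ v : Fin (r + 1) → ℚ, (∀ a, gamVec h a ⬝ᵥ v = 0) → ∃ t : ℚ, v = t • lam := by
  obtain ⟨j, hj⟩ := exists_single_notMem hr
  have hlt : GammaSpace h < ⊤ := lt_top_iff_ne_top.mpr (fun e => hj (by rw [e]; trivial))
  obtain ⟨f, hf0, hf⟩ := Submodule.exists_le_ker_of_lt_top _ hlt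
  have hdot : ∀ x, x ⬝ᵥ (fun i => f (Pi.single i 1)) = f x := by
    intro x
    conv_rhs => rw [pi_eq_sum_univ' x]
    simp only [map_sum, map_smul, dotProduct, smul_eq_mul]
  set lam : Fin (r + 1) → ℚ := fun i => f (Pi.single i 1) with hlam
  have hp : ∀ a, gamVec h a ⬝ᵥ lam = 0 := fun a => by
    rw [hdot]; exact hf (gamVec_mem h a)
  have hl0 : lam ≠ 0 := by
    intro e
    apply hf0
    ext i
    simpa using congrFun e i
  have hlj : lam j ≠ 0 := fun e => hl0 (perp_eq_zero hr hj hp e)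
  refine ⟨lam, hl0, hp, fun v hv => ⟨v j / lam j, ?_⟩⟩
  rw [← sub_eq_zero]
  apply perp_eq_zero hr hj
  · intro a
    rw [dotProduct_sub, dotProduct_smul, hv, hp]; simp
  · simp [hlj]

theorem single_notMem_of_nil {n c : ℕ} {h : Fin n → List (Fin c)} {i : Fin n} (hi : h i = []) :
    (Pi.single i 1 : Fin n → ℚ) ∉ GammaSpace h := by
  intro hm
  have := perp_space (h := h) (v := Pi.single i 1) (by intro a; simp [gamVec, hi]) hm
  simp at this

theorem nil_unique (hr : morphRank h = r) (i j : Fin (r + 1)) (hi : h i = []) (hj : h j = []) :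
    i = j := by
  by_contra hne
  have := perp_eq_zero hr (single_notMem_of_nil hi) (v := Pi.single j 1)
    (by intro a; simp [gamVec, hj]) (by simp [hne])
  have := congrFun this j
  simp at this

theorem fox_kernel (hr : morphRank h = r) {j : Fin (r + 1)}
    (hj : (Pi.single j 1 : Fin (r + 1) → ℚ) ∉ GammaSpace h)
    {s : Fin (r + 1) → MvPolynomial (Fin c) ℤ}
    (hs : ∀ a, ∑ l, s l * fox MvPolynomial.X a (h l) = 0) (hsj : s j = 0) : s = 0 := by
  have hfin : finrank ℚ (Submodule.span ℚ (Set.range (gamVec h))) = r := hr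
  have hex := Submodule.exists_fun_fin_finrank_span_eq ℚ (Set.range (gamVec h))
  rw [hfin] at hex
  obtain ⟨f, hf, hspan, hli⟩ := hex
  choose a ha using hf
  let M : Matrix (Fin (r + 1)) (Fin (r + 1)) (MvPolynomial (Fin c) ℤ) :=
    Matrix.of (Fin.cons (Pi.single j 1) (fun i l => fox MvPolynomial.X (a i) (h l)))
  let ev : MvPolynomial (Fin c) ℤ →+* ℚ :=
    MvPolynomial.eval₂Hom (Int.castRingHom ℚ) (fun _ => 1)
  let N : Matrix (Fin (r + 1)) (Fin (r + 1)) ℚ := Matrix.of (Fin.cons (Pi.single j 1) f)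
  have hev : ev.mapMatrix M = N := by
    ext i l
    rw [RingHom.mapMatrix_apply, Matrix.map_apply]
    refine Fin.cases ?_ (fun i => ?_) i
    · simp only [M, N, Matrix.of_apply, Fin.cons_zero, Pi.single_apply]
      split_ifs <;> simp
    · simp only [M, N, Matrix.of_apply, Fin.cons_succ]
      rw [fox_map, ← ha]
      have : (fun x => ev (MvPolynomial.X x)) = fun _ => (1 : ℚ) := by
        funext x; simp [ev]
      rw [this, fox_one]
      rfl
  have hdet : M.det ≠ 0 := by
    intro h0
    have h1 := RingHom.map_det ev M
    rw [h0, map_zero, hev] at h1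
    have h2 : LinearIndependent ℚ (Fin.cons (Pi.single j 1) f : Fin (r + 1) → Fin (r + 1) → ℚ) :=
      linearIndependent_finCons.mpr ⟨hli, by rw [hspan]; exact hj⟩
    have h3 := (Matrix.linearIndependent_rows_iff_isUnit (A := N)).mp h2
    rw [Matrix.isUnit_iff_isUnit_det] at h3
    exact h3.ne_zero h1.symm
  apply Matrix.eq_zero_of_mulVec_eq_zero hdet
  ext1 i
  refine Fin.cases ?_ (fun i => ?_) i
  · simp [Matrix.mulVec, M, hsj]
  · simp only [Matrix.mulVec, M, Matrix.of_apply, Fin.cons_succ, Pi.zero_apply, dotProduct]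
    rw [← hs (a i)]
    exact Finset.sum_congr rfl fun _ _ => mul_comm _ _

end LinAlg

/-! ### Supports -/

/-- The exponents occurring in the Fox derivative of a word. -/
noncomputable def chainSet {n : ℕ} (k : Fin n) : List (Fin n) → Finset (Fin n →₀ ℕ)
  | [] => ∅
  | b :: w => (if b = k then {0} else ∅) ∪
      (chainSet k w).image (fun α => Finsupp.single b 1 + α)

theorem fox_support {n : ℕ} (k : Fin n) (w : List (Fin n)) :
    (fox (MvPolynomial.X : Fin n → MvPolynomial (Fin n) ℤ) k w).support ⊆ chainSet k w := by
  induction w with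
  | nil => simp [fox]
  | cons b w ih =>
    simp only [fox, chainSet]
    refine (MvPolynomial.support_add).trans (Finset.union_subset_union ?_ ?_)
    · split_ifs
      · intro α hα
        simp only [MvPolynomial.mem_support_iff, MvPolynomial.coeff_one] at hα
        simp only [Finset.mem_singleton]
        by_contra hne
        exact hα (if_neg (fun e => hne e.symm))
      · simp
    · rw [MvPolynomial.support_X_mul]
      intro α hα
      simp only [Finset.mem_map] at hα
      obtain ⟨β, hβ, rfl⟩ := hα
      exact Finset.mem_image.mpr ⟨β, ih hβ, rfl⟩

theorem chainSet_card {n : ℕ} (k : Fin n) (w : List (Fin n)) :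
    (chainSet k w).card ≤ w.count k := by
  induction w with
  | nil => simp [chainSet]
  | cons b w ih =>
    simp only [chainSet, List.count_cons, beq_iff_eq]
    refine (Finset.card_union_le _ _).trans ?_
    have := Finset.card_image_le (s := chainSet k w) (f := fun α => Finsupp.single b 1 + α)
    split_ifs <;> simp <;> omega

theorem chainSet_chain {n : ℕ} (k : Fin n) (w : List (Fin n)) :
    ∀ α ∈ chainSet k w, ∀ β ∈ chainSet k w, α ≤ β ∨ β ≤ α := by
  induction w with
  | nil => simp [chainSet]
  | cons b w ih =>
    intro α hα β hβ
    simp only [chainSet, Finset.mem_union, Finset.mem_image] at hα hβ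
    rcases hα with hα | ⟨α', hα', rfl⟩
    · have : α = 0 := by split_ifs at hα <;> simp_all
      subst this
      exact Or.inl (zero_le)
    · rcases hβ with hβ | ⟨β', hβ', rfl⟩
      · have : β = 0 := by split_ifs at hβ <;> simp_all
        subst this
        exact Or.inr (zero_le)
      · exact (ih _ hα' _ hβ').imp (fun h => by gcongr) (fun h => by gcongr)

theorem chainSet_inj {n : ℕ} (k : Fin n) (w : List (Fin n)) :
    ∀ α ∈ chainSet k w, ∀ β ∈ chainSet k w, α k = β k → α = β := by
  induction w with
  | nil => simp [chainSet]
  | cons b w ih =>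
    intro α hα β hβ hk
    simp only [chainSet, Finset.mem_union, Finset.mem_image] at hα hβ
    rcases hα with hα | ⟨α', hα', rfl⟩ <;> rcases hβ with hβ | ⟨β', hβ', rfl⟩
    · split_ifs at hα hβ <;> simp_all
    · split_ifs at hα with hb
      · simp only [Finset.mem_singleton] at hα
        subst hα hb
        simp at hk
        omega
      · simp at hα
    · split_ifs at hβ with hb
      · simp only [Finset.mem_singleton] at hβ
        subst hβ hb
        simp at hk
      · simp at hβ
    · simp only [Finsupp.coe_add, Pi.add_apply, add_right_inj] at hk
      rw [ih _ hα' _ hβ' hk]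

/-- An antichain contained in the sum of two chains is small. -/
theorem antichain_card {n : ℕ} (M C D : Finset (Fin n →₀ ℕ))
    (hM : ∀ α ∈ M, ∀ β ∈ M, β ≤ α → β = α)
    (hD : ∀ α ∈ D, ∀ β ∈ D, α ≤ β ∨ β ≤ α)
    (hsub : ∀ α ∈ M, ∃ x ∈ C, ∃ y ∈ D, α = x + y) : M.card ≤ C.card := by
  choose! f hf g hg hfg using hsub
  refine Finset.card_le_card_of_injOn f (fun α hα => hf α hα) ?_
  intro α hα β hβ he
  rcases hD _ (hg α hα) _ (hg β hβ) with hle | hle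
  · apply hM β hβ α hα
    rw [hfg α hα, hfg β hβ, he]
    gcongr
  · symm
    apply hM α hα β hβ
    rw [hfg α hα, hfg β hβ, he]
    gcongr

/-- The substitution `X_i ↦ Y^{h(x_i)}`. -/
noncomputable def subst {n c : ℕ} (h : Fin n → List (Fin c)) :
    MvPolynomial (Fin n) ℤ →+* MvPolynomial (Fin c) ℤ :=
  MvPolynomial.eval₂Hom MvPolynomial.C (fun i => mon (h i))

theorem subst_X {n c : ℕ} (h : Fin n → List (Fin c)) (i : Fin n) :
    subst h (MvPolynomial.X i) = mon (h i) := by simp [subst]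

theorem subst_fox {n c : ℕ} (h : Fin n → List (Fin c)) (k : Fin n) (w : List (Fin n)) :
    subst h (fox MvPolynomial.X k w) = fox (fun i => mon (h i)) k w := by
  rw [fox_map]; simp only [subst_X]

theorem subst_mon {n c : ℕ} (h : Fin n → List (Fin c)) (w : List (Fin n)) :
    subst h (mon w) = mon (w.flatMap h) := by
  induction w with
  | nil => simp [mon]
  | cons b w ih =>
    simp only [mon, List.map_cons, List.prod_cons, map_mul, subst_X, List.flatMap_cons,
      List.map_append, List.prod_append] at ih ⊢
    rw [ih]

/-- The exponent of a word. -/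
noncomputable def ew {c : ℕ} (w : List (Fin c)) : Fin c →₀ ℕ := Finsupp.equivFunOnFinite.symm (fun a => w.count a)

theorem mon_eq {c : ℕ} (w : List (Fin c)) : mon w = MvPolynomial.monomial (ew w) 1 := by
  induction w with
  | nil =>
    have : ew ([] : List (Fin c)) = 0 := by ext; simp [ew]
    rw [this]; simp [mon]
  | cons b w ih =>
    have : ew (b :: w) = Finsupp.single b 1 + ew w := by
      ext a
      simp only [ew, Finsupp.equivFunOnFinite_symm_apply_apply, List.count_cons, Finsupp.coe_add,
        Pi.add_apply, Finsupp.single_apply, beq_iff_eq]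
      split_ifs <;> omega
    rw [this]
    simp only [mon, List.map_cons, List.prod_cons] at ih ⊢
    rw [ih, MvPolynomial.X, MvPolynomial.monomial_mul, one_mul]

/-- The image of an exponent. -/
noncomputable def img {n c : ℕ} (h : Fin n → List (Fin c)) (α : Fin n →₀ ℕ) : Fin c →₀ ℕ :=
  ∑ l, α l • ew (h l)

theorem subst_monomial {n c : ℕ} (h : Fin n → List (Fin c)) (α : Fin n →₀ ℕ) (t : ℤ) :
    subst h (MvPolynomial.monomial α t) = MvPolynomial.monomial (img h α) t := by
  unfold subst
  rw [MvPolynomial.coe_eval₂Hom, MvPolynomial.eval₂_monomial, Finsupp.prod_fintype _ _ (by simp)]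
  simp only [mon_eq, MvPolynomial.monomial_pow, one_pow]
  rw [← MvPolynomial.monomial_sum_one, MvPolynomial.C_mul_monomial, mul_one]
  rfl

/-- The rational vector of an exponent. -/
def qv {n : ℕ} (α : Fin n →₀ ℕ) : Fin n → ℚ := fun l => (α l : ℚ)

theorem img_apply {n c : ℕ} (h : Fin n → List (Fin c)) (α : Fin n →₀ ℕ) (a : Fin c) :
    ((img h α a : ℕ) : ℚ) = gamVec h a ⬝ᵥ qv α := by
  simp [img, ew, gamVec, qv, dotProduct, Finsupp.finsetSum_apply, mul_comm]

theorem exists_other {n c : ℕ} (h : Fin n → List (Fin c)) (p : MvPolynomial (Fin n) ℤ)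
    (hp : subst h p = 0) (α : Fin n →₀ ℕ) (hα : α ∈ p.support) :
    ∃ β ∈ p.support, β ≠ α ∧ ∀ a, gamVec h a ⬝ᵥ (qv β - qv α) = 0 := by
  by_contra! hcon
  have hne : ∀ β ∈ p.support, β ≠ α → img h β ≠ img h α := by
    intro β hβ hne he
    obtain ⟨a, ha⟩ := hcon β hβ hne
    apply ha
    rw [dotProduct_sub, ← img_apply, ← img_apply, he, sub_self]
  have h1 : (subst h p).coeff (img h α) = 0 := by rw [hp]; simp
  rw [p.as_sum, map_sum, MvPolynomial.coeff_sum,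
    Finset.sum_eq_single_of_mem α hα] at h1
  · rw [subst_monomial, MvPolynomial.coeff_monomial, if_pos rfl] at h1
    exact (MvPolynomial.mem_support_iff.mp hα) h1
  · intro β hβ hβα
    rw [subst_monomial, MvPolynomial.coeff_monomial, if_neg (hne β hβ hβα)]

/-! ### Many minimal monomials -/

theorem lex_smul_pos {k : ℕ} {x : Fin k → ℚ} {t : ℚ} (ht : 0 < t) (hx : (0 : Lex (Fin k → ℚ)) < toLex x) :
    (0 : Lex (Fin k → ℚ)) < toLex (t • x) := by
  obtain ⟨i, hi, hlt⟩ := hx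
  refine ⟨i, fun j hj => ?_, ?_⟩
  · have := hi j hj
    change (0 : ℚ) = x j at this
    change (0 : ℚ) = t * x j
    rw [← this, mul_zero]
  · change (0 : ℚ) < x i at hlt
    change (0 : ℚ) < t * x i
    exact mul_pos ht hlt

/-- The lexicographic weight of a vector. -/
noncomputable def wt {n c : ℕ} (h : Fin n → List (Fin c)) (v : Fin n → ℚ) : Lex (Fin c → ℚ) :=
  toLex (fun a => gamVec h a ⬝ᵥ v)

theorem wt_sub {n c : ℕ} (h : Fin n → List (Fin c)) (v w : Fin n → ℚ) :
    wt h (v - w) = wt h v - wt h w := by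
  unfold wt
  simp only [dotProduct_sub]
  rfl

theorem wt_zero_iff {n c : ℕ} (h : Fin n → List (Fin c)) (v : Fin n → ℚ) :
    wt h v = 0 ↔ ∀ a, gamVec h a ⬝ᵥ v = 0 :=
  ⟨fun e a => congrFun (congrArg ofLex e) a, fun e => congrArg toLex (funext e)⟩

theorem wt_smul_pos {n c : ℕ} (h : Fin n → List (Fin c)) (v : Fin n → ℚ) (t : ℚ) (ht : 0 < t)
    (hv : 0 < wt h v) : 0 < wt h (t • v) := by
  have := lex_smul_pos ht hv
  convert this using 1
  unfold wt
  congr 1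
  funext a
  simp

theorem wt_neg {n c : ℕ} (h : Fin n → List (Fin c)) (v : Fin n → ℚ) :
    wt h (-v) = - wt h v := by
  unfold wt
  simp only [dotProduct_neg]
  rfl

/-- Positive weights: componentwise strictly smaller vectors have a smaller weight. -/
theorem wt_lt {n c : ℕ} (h : Fin n → List (Fin c)) (hpos : ∀ l, h l ≠ [])
    (α β : Fin n →₀ ℕ) (hle : β ≤ α) (hw : wt h (qv α) ≤ wt h (qv β)) : β = α := by
  have hcomp : ∀ a, gamVec h a ⬝ᵥ qv β ≤ gamVec h a ⬝ᵥ qv α := by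
    intro a
    refine Finset.sum_le_sum fun l _ => ?_
    refine mul_le_mul_of_nonneg_left ?_ (by simp [gamVec])
    exact Nat.cast_le.mpr (hle l)
  have hw2 : wt h (qv β) ≤ wt h (qv α) := Pi.toLex_monotone (fun a => hcomp a)
  have heq := le_antisymm hw hw2
  have heq' : ∀ a, gamVec h a ⬝ᵥ qv α = gamVec h a ⬝ᵥ qv β :=
    fun a => congrFun (congrArg ofLex heq) a
  ext l
  obtain ⟨a, ha⟩ := List.exists_mem_of_ne_nil _ (hpos l)
  have h1 := heq' a
  have h2 := (Finset.sum_eq_sum_iff_of_le (s := Finset.univ)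
    (f := fun l => gamVec h a l * qv β l) (g := fun l => gamVec h a l * qv α l) (by
      intro l _
      refine mul_le_mul_of_nonneg_left ?_ (by simp [gamVec])
      exact Nat.cast_le.mpr (hle l))).mp h1.symm l (Finset.mem_univ l)
  have h3 : gamVec h a l ≠ 0 := by
    have := List.count_pos_iff.mpr ha
    simp only [gamVec]
    positivity
  have h4 := mul_left_cancel₀ h3 h2
  exact Nat.cast_injective (R := ℚ) h4

theorem affine_count {T I : Type*} [DecidableEq T] [Fintype I] [DecidableEq I] (M : Finset T)
    (hM : M.Nonempty) (f : T → I → ℚ)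
    (hf : ∀ i, ∃ a ∈ M, ∃ b ∈ M, f a - f b = Pi.single i 1) :
    Fintype.card I + 1 ≤ M.card := by
  classical
  obtain ⟨x, hx⟩ := hM
  set S : Finset (I → ℚ) := (M.erase x).image (fun a => f a - f x) with hS
  have hmem : ∀ a ∈ M, f a - f x ∈ Submodule.span ℚ (S : Set (I → ℚ)) := by
    intro a ha
    by_cases hax : a = x
    · rw [hax, sub_self]; exact Submodule.zero_mem _
    · apply Submodule.subset_span
      rw [hS]
      exact Finset.mem_coe.mpr
        (Finset.mem_image.mpr ⟨a, Finset.mem_erase.mpr ⟨hax, ha⟩, rfl⟩)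
  have htop : Submodule.span ℚ (S : Set (I → ℚ)) = ⊤ := by
    rw [eq_top_iff]
    intro v _
    rw [pi_eq_sum_univ' v]
    refine Submodule.sum_mem _ fun i _ => Submodule.smul_mem _ _ ?_
    obtain ⟨a, ha, b, hb, hab⟩ := hf i
    have := Submodule.sub_mem _ (hmem a ha) (hmem b hb)
    rw [sub_sub_sub_cancel_right, hab] at this
    exact this
  have h1 := finrank_span_finset_le_card (R := ℚ) S
  unfold Set.finrank at h1
  rw [htop, finrank_top, Module.finrank_fintype_fun_eq_card] at h1
  have h2 : S.card ≤ (M.erase x).card := Finset.card_image_le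
  rw [Finset.card_erase_of_mem hx] at h2
  have : 0 < M.card := Finset.card_pos.mpr ⟨x, hx⟩
  omega

theorem many_minimal {n : ℕ} {I : Type*} [Fintype I] [DecidableEq I]
    (A : Finset (Fin n →₀ ℕ)) (hA : A.Nonempty) (K : I → ℕ)
    (h : (i : I) → Fin n → List (Fin (K i))) (lam : I → Fin n → ℚ)
    (hmul : ∀ i (v : Fin n → ℚ), (∀ a, gamVec (h i) a ⬝ᵥ v = 0) → ∃ t : ℚ, v = t • lam i)
    (hlam : ∀ i, lam i ≠ 0)
    (hsep : ∀ i j, i ≠ j → ¬ ∀ a, gamVec (h i) a ⬝ᵥ lam j = 0)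
    (hpos : ∀ i l, h i l ≠ [])
    (hother : ∀ i, ∀ α ∈ A, ∃ β ∈ A, β ≠ α ∧ ∀ a, gamVec (h i) a ⬝ᵥ (qv β - qv α) = 0) :
    Fintype.card I + 1 ≤ (A.filter (fun α => ∀ β ∈ A, β ≤ α → β = α)).card := by
  classical
  have hqv : ∀ α β : Fin n →₀ ℕ, qv α = qv β → α = β := by
    intro α β e
    ext l
    exact Nat.cast_injective (R := ℚ) (congrFun e l)
  have hsq : ∀ i, 0 < lam i ⬝ᵥ lam i := by
    intro i
    have h0 : 0 ≤ lam i ⬝ᵥ lam i := Finset.sum_nonneg fun l _ => mul_self_nonneg _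
    exact lt_of_le_of_ne h0 (fun e => hlam i (dotProduct_self_eq_zero.mp e.symm))
  refine affine_count _ ?_
    (fun α i => if ∃ β ∈ A, ∃ t : ℚ, 0 < t ∧ qv β - qv α = t • lam i then 1 else 0) ?_
  · obtain ⟨α, hα⟩ := A.exists_minimal hA
    refine ⟨α, Finset.mem_filter.mpr ⟨hα.1, fun β hβ hle => le_antisymm hle (hα.2 hβ hle)⟩⟩
  · intro i
    obtain ⟨α₀, hα₀, hmin⟩ := A.exists_min_image (fun α => wt (h i) (qv α)) hA
    set F := A.filter (fun α => wt (h i) (qv α) = wt (h i) (qv α₀)) with hF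
    have hFA : ∀ α ∈ F, α ∈ A := fun α hα => (Finset.mem_filter.mp hα).1
    have hFw : ∀ α ∈ F, ∀ β ∈ A, wt (h i) (qv α) ≤ wt (h i) (qv β) := fun α hα β hβ => by
      rw [(Finset.mem_filter.mp hα).2]; exact hmin β hβ
    have hFne : F.Nonempty := ⟨α₀, Finset.mem_filter.mpr ⟨hα₀, rfl⟩⟩
    have hFmem : ∀ α ∈ F, ∀ β ∈ A, (∀ a, gamVec (h i) a ⬝ᵥ (qv β - qv α) = 0) → β ∈ F := by
      intro α hα β hβ hp
      refine Finset.mem_filter.mpr ⟨hβ, ?_⟩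
      rw [← (Finset.mem_filter.mp hα).2, ← sub_eq_zero, ← wt_sub, wt_zero_iff]
      exact hp
    have hFmin : ∀ α ∈ F, α ∈ A.filter (fun α => ∀ β ∈ A, β ≤ α → β = α) := fun α hα =>
      Finset.mem_filter.mpr ⟨hFA α hα, fun β hβ hle => wt_lt (h i) (hpos i) α β hle (hFw α hα β hβ)⟩
    have hpl : ∀ a, gamVec (h i) a ⬝ᵥ lam i = 0 := by
      obtain ⟨β, hβ, hne, hp⟩ := hother i α₀ hα₀
      obtain ⟨t, ht⟩ := hmul i _ hp
      have ht0 : t ≠ 0 := by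
        rintro rfl
        rw [zero_smul, sub_eq_zero] at ht
        exact hne (hqv _ _ ht)
      intro a
      have := hp a
      rw [ht, dotProduct_smul, smul_eq_mul] at this
      exact (mul_eq_zero.mp this).resolve_left ht0
    obtain ⟨x, hx, hxmin⟩ := F.exists_min_image (fun α => lam i ⬝ᵥ qv α) hFne
    obtain ⟨y, hy, hymax⟩ := F.exists_max_image (fun α => lam i ⬝ᵥ qv α) hFne
    refine ⟨x, hFmin x hx, y, hFmin y hy, ?_⟩
    funext j
    simp only [Pi.sub_apply]
    by_cases hij : j = i
    · subst hij
      rw [Pi.single_eq_same, if_pos, if_neg, sub_zero]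
      · rintro ⟨β, hβ, t, ht, e⟩
        have hβF := hFmem y hy β hβ (by
          intro a; rw [e, dotProduct_smul, hpl, smul_zero])
        have h1 := hymax β hβF
        have h2 : lam j ⬝ᵥ (qv β - qv y) = t * (lam j ⬝ᵥ lam j) := by
          rw [e, dotProduct_smul, smul_eq_mul]
        rw [dotProduct_sub] at h2
        have := mul_pos ht (hsq j)
        linarith
      · obtain ⟨β, hβ, hne, hp⟩ := hother j x (hFA x hx)
        obtain ⟨t, ht⟩ := hmul j _ hp
        have ht0 : t ≠ 0 := by
          rintro rfl
          rw [zero_smul, sub_eq_zero] at ht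
          exact hne (hqv _ _ ht)
        have h1 := hxmin β (hFmem x hx β hβ hp)
        have h2 : lam j ⬝ᵥ (qv β - qv x) = t * (lam j ⬝ᵥ lam j) := by
          rw [ht, dotProduct_smul, smul_eq_mul]
        rw [dotProduct_sub] at h2
        refine ⟨β, hβ, t, lt_of_le_of_ne ?_ ht0.symm, ht⟩
        by_contra hneg
        have := mul_neg_of_neg_of_pos (not_le.mp hneg) (hsq j)
        linarith
    · rw [Pi.single_eq_of_ne hij, sub_eq_zero]
      have hne0 : wt (h i) (lam j) ≠ 0 := fun e =>
        hsep i j (fun e => hij e.symm) ((wt_zero_iff _ _).mp e)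
      rcases lt_or_gt_of_ne hne0 with hlt | hgt
      · have hno : ∀ α ∈ F, ¬ ∃ β ∈ A, ∃ t : ℚ, 0 < t ∧ qv β - qv α = t • lam j := by
          rintro α hα ⟨β, hβ, t, ht, e⟩
          have h1 := wt_smul_pos (h i) (-lam j) t ht (by rw [wt_neg]; exact neg_pos.mpr hlt)
          rw [smul_neg, ← e, wt_neg, wt_sub] at h1
          have h2 := hFw α hα β hβ
          rw [neg_sub, sub_pos] at h1
          exact absurd h1 (not_lt.mpr h2)
        rw [if_neg (hno x hx), if_neg (hno y hy)]
      · have hyes : ∀ α ∈ F, ∃ β ∈ A, ∃ t : ℚ, 0 < t ∧ qv β - qv α = t • lam j := by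
          intro α hα
          obtain ⟨β, hβ, hne, hp⟩ := hother j α (hFA α hα)
          obtain ⟨t, ht⟩ := hmul j _ hp
          have ht0 : t ≠ 0 := by
            rintro rfl
            rw [zero_smul, sub_eq_zero] at ht
            exact hne (hqv _ _ ht)
          refine ⟨β, hβ, t, lt_of_le_of_ne ?_ ht0.symm, ht⟩
          by_contra hneg
          have h1 := wt_smul_pos (h i) (lam j) (-t) (by linarith) hgt
          rw [neg_smul, ← ht, wt_neg, wt_sub, neg_sub, sub_pos] at h1
          exact absurd h1 (not_lt.mpr (hFw α hα β hβ))
        rw [if_pos (hyes x hx), if_pos (hyes y hy)]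

/-! ### The minors -/

section Minors
open MvPolynomial

/-- The polynomial `S_{E,x_k}` as a difference of Fox derivatives. -/
noncomputable def SS {n : ℕ} (E : List (Fin n) × List (Fin n)) (k : Fin n) :
    MvPolynomial (Fin n) ℤ := fox X k E.1 - fox X k E.2

/-- The two by two minors. -/
noncomputable def tt {n : ℕ} (E E' : List (Fin n) × List (Fin n)) (k l : Fin n) :
    MvPolynomial (Fin n) ℤ := SS E k * SS E' l - SS E l * SS E' k

theorem SS_sum {n c : ℕ} (E : List (Fin n) × List (Fin n)) (h : Fin n → List (Fin c)) (a : Fin c) :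
    ∑ l, subst h (SS E l) * fox X a (h l) =
      fox X a (E.1.flatMap h) - fox X a (E.2.flatMap h) := by
  rw [fox_flatMap, fox_flatMap, ← Finset.sum_sub_distrib]
  refine Finset.sum_congr rfl fun l _ => ?_
  rw [SS, map_sub, subst_fox, subst_fox, sub_mul]

theorem SS_sum_zero {n c : ℕ} {E : List (Fin n) × List (Fin n)} {h : Fin n → List (Fin c)}
    (hE : IsSolutionE h E) (a : Fin c) : ∑ l, subst h (SS E l) * fox X a (h l) = 0 := by
  rw [SS_sum, hE, sub_self]

theorem sol_of_sum {n c : ℕ} {E : List (Fin n) × List (Fin n)} {h : Fin n → List (Fin c)}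
    (hE : ∀ a, ∑ l, subst h (SS E l) * fox X a (h l) = 0) : IsSolutionE h E := by
  apply fox_inj
  intro a
  have := hE a
  rw [SS_sum] at this
  exact sub_eq_zero.mp this

variable {r : ℕ} {E E' : List (Fin (r + 1)) × List (Fin (r + 1))}

theorem subst_tt {c : ℕ} {h : Fin (r + 1) → List (Fin c)} (hr : morphRank h = r)
    (hE : IsSolutionE h E) (hE' : IsSolutionE h E') (k l : Fin (r + 1)) :
    subst h (tt E E' k l) = 0 := by
  obtain ⟨j, hj⟩ := exists_single_notMem hr
  set s : Fin (r + 1) → MvPolynomial (Fin c) ℤ := fun k => subst h (SS E k) with hs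
  set s' : Fin (r + 1) → MvPolynomial (Fin c) ℤ := fun k => subst h (SS E' k) with hs'
  have h1 : (fun k => s j * s' k - s' j * s k) = 0 := by
    apply fox_kernel hr hj
    · intro a
      have e1 := SS_sum_zero hE a
      have e2 := SS_sum_zero hE' a
      simp only [sub_mul, Finset.sum_sub_distrib, mul_assoc, ← Finset.mul_sum, hs, hs', e1, e2]
      simp
    · ring
  have h2 : ∀ k, s j * s' k = s' j * s k := fun k => sub_eq_zero.mp (congrFun h1 k)
  have goal : s k * s' l - s l * s' k = 0 := by
    by_cases hz : s j = 0
    · have : s = 0 := fox_kernel hr hj (SS_sum_zero hE) hz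
      simp [this]
    · apply mul_left_cancel₀ hz
      linear_combination s k * h2 l - s l * h2 k
  simpa [tt, hs, hs'] using goal

theorem exists_tt {c : ℕ} {g : Fin (r + 1) → List (Fin c)} (hr : morphRank g = r)
    (hE : IsSolutionE g E) (hE' : ¬ IsSolutionE g E') (hne : E.1 ≠ E.2) :
    ∃ k l, tt E E' k l ≠ 0 := by
  by_contra! hcon
  apply hne
  apply fox_mon_inj g (nil_unique hr)
  by_contra! hk
  obtain ⟨k, hk⟩ := hk
  have hk' : subst g (SS E k) ≠ 0 := by
    rw [SS, map_sub, subst_fox, subst_fox]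
    exact sub_ne_zero.mpr hk
  apply hE'
  apply sol_of_sum
  intro a
  apply mul_left_cancel₀ hk'
  rw [mul_zero, Finset.mul_sum]
  have : ∀ l, subst g (SS E k) * (subst g (SS E' l) * fox X a (g l)) =
      subst g (SS E' k) * (subst g (SS E l) * fox X a (g l)) := by
    intro l
    have := congrArg (subst g) (hcon k l)
    rw [tt, map_sub, map_mul, map_mul, map_zero] at this
    linear_combination (fox X a (g l)) * this
  simp only [this]
  rw [← Finset.mul_sum, SS_sum_zero hE, mul_zero]

theorem subst_SS_nil {c : ℕ} {h : Fin (r + 1) → List (Fin c)} (hr : morphRank h = r)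
    (hE : IsSolutionE h E) {i : Fin (r + 1)} (hi : h i = []) (k : Fin (r + 1)) (hk : k ≠ i) :
    subst h (SS E k) = 0 := by
  have := fox_kernel hr (single_notMem_of_nil hi) (s := Function.update
    (fun k => subst h (SS E k)) i 0) (by
      intro a
      rw [← SS_sum_zero hE a]
      refine Finset.sum_congr rfl fun l _ => ?_
      by_cases hl : l = i
      · subst hl; rw [hi]; simp [fox]
      · rw [Function.update_of_ne hl]) (by simp)
  have := congrFun this k
  rwa [Function.update_of_ne hk] at this

theorem perp_nil {c : ℕ} {h : Fin (r + 1) → List (Fin c)} (hr : morphRank h = r)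
    {i : Fin (r + 1)} (hi : h i = []) {v : Fin (r + 1) → ℚ} (hv : ∀ a, gamVec h a ⬝ᵥ v = 0)
    (k : Fin (r + 1)) (hk : k ≠ i) : v k = 0 := by
  have := perp_eq_zero hr (single_notMem_of_nil hi) (v := Function.update v i 0) (by
      intro a
      rw [← hv a]
      refine Finset.sum_congr rfl fun l _ => ?_
      by_cases hl : l = i
      · subst hl; simp [gamVec, hi]
      · rw [Function.update_of_ne hl]) (by simp)
  have := congrFun this k
  rwa [Function.update_of_ne hk] at this

theorem poly_zero {c d : ℕ} {h : Fin (r + 1) → List (Fin c)} {h' : Fin (r + 1) → List (Fin d)}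
    (hr : morphRank h = r) (hr' : morphRank h' = r) {i j : Fin (r + 1)} (hij : i ≠ j)
    (hi : h i = []) (hj : h' j = []) (p : MvPolynomial (Fin (r + 1)) ℤ)
    (hp : subst h p = 0) (hp' : subst h' p = 0)
    (hU : ∀ α ∈ p.support, ∀ β ∈ p.support, ∀ γ ∈ p.support, (∀ l, l ≠ i → β l = α l) →
      (∀ l, l ≠ j → γ l = α l) → β = α ∨ γ = α ∨ β = γ) : p = 0 := by
  by_contra hne
  obtain ⟨α, hα⟩ := Finset.nonempty_iff_ne_empty.mpr (fun e => hne (support_eq_empty.mp e))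
  obtain ⟨β, hβ, hβα, hβp⟩ := exists_other h p hp α hα
  obtain ⟨γ, hγ, hγα, hγp⟩ := exists_other h' p hp' α hα
  have h1 : ∀ l, l ≠ i → β l = α l := fun l hl =>
    Nat.cast_injective (R := ℚ) (sub_eq_zero.mp (perp_nil hr hi hβp l hl))
  have h2 : ∀ l, l ≠ j → γ l = α l := fun l hl =>
    Nat.cast_injective (R := ℚ) (sub_eq_zero.mp (perp_nil hr' hj hγp l hl))
  rcases hU α hα β hβ γ hγ h1 h2 with e | e | e
  · exact hβα e
  · exact hγα e
  · apply hβα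
    ext l
    by_cases hl : l = i
    · rw [e]; exact h2 l (fun e' => hij (hl.symm.trans e'))
    · exact h1 l hl

theorem SS_support {n : ℕ} (E : List (Fin n) × List (Fin n)) (k : Fin n) :
    (SS E k).support ⊆ chainSet k E.1 ∪ chainSet k E.2 := by
  refine (support_sub _ _ _).trans (Finset.union_subset_union (fox_support _ _) (fox_support _ _))

theorem two_coord_aux {c d : ℕ} {h : Fin (r + 1) → List (Fin c)}
    {h' : Fin (r + 1) → List (Fin d)}
    (hr : morphRank h = r) (hr' : morphRank h' = r) {i j : Fin (r + 1)} (hij : i ≠ j)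
    (hi : h i = []) (hj : h' j = []) (hE : IsSolutionE h E) (hE' : IsSolutionE h' E) :
    (∀ k, k ≠ i → k ≠ j → SS E k = 0) ∧ SS E i * (X i - 1) + SS E j * (X j - 1) = 0 := by
  have hz : ∀ k, k ≠ i → k ≠ j → SS E k = 0 := by
    intro k hki hkj
    refine poly_zero hr hr' hij hi hj _ (subst_SS_nil hr hE hi k hki)
      (subst_SS_nil hr' hE' hj k hkj) ?_
    intro α hα β hβ γ hγ h1 h2
    have i1 := chainSet_inj k E.1
    have i2 := chainSet_inj k E.2
    have e1 := h1 k hki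
    have e2 := h2 k hkj
    rcases Finset.mem_union.mp (SS_support E k hα) with a1 | a1 <;>
    rcases Finset.mem_union.mp (SS_support E k hβ) with b1 | b1 <;>
    rcases Finset.mem_union.mp (SS_support E k hγ) with c1 | c1
    · exact Or.inl (i1 _ b1 _ a1 e1)
    · exact Or.inl (i1 _ b1 _ a1 e1)
    · exact Or.inr (Or.inl (i1 _ c1 _ a1 e2))
    · exact Or.inr (Or.inr (i2 _ b1 _ c1 (e1.trans e2.symm)))
    · exact Or.inr (Or.inr (i1 _ b1 _ c1 (e1.trans e2.symm)))
    · exact Or.inr (Or.inl (i2 _ c1 _ a1 e2))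
    · exact Or.inl (i2 _ b1 _ a1 e1)
    · exact Or.inl (i2 _ b1 _ a1 e1)
  refine ⟨hz, ?_⟩
  have hb : mon E.1 - mon E.2 = 0 := by
    refine poly_zero hr hr' hij hi hj _ ?_ ?_ ?_
    · rw [map_sub, subst_mon, subst_mon, hE, sub_self]
    · rw [map_sub, subst_mon, subst_mon, hE', sub_self]
    · have key : ∀ α ∈ (mon E.1 - mon E.2).support, α = ew E.1 ∨ α = ew E.2 := by
        intro α hα
        by_contra! hcon
        rw [mem_support_iff, coeff_sub, mon_eq, mon_eq, coeff_monomial, coeff_monomial,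
          if_neg hcon.1.symm, if_neg hcon.2.symm] at hα
        exact hα (sub_self 0)
      intro α hα β hβ γ hγ _ _
      rcases key α hα with rfl | rfl <;> rcases key β hβ with e | e <;>
        rcases key γ hγ with e' | e' <;> simp [e, e']
  have hf : ∑ k, SS E k * (X k - 1) = 0 := by
    simp only [SS, sub_mul, Finset.sum_sub_distrib, fox_fund]
    rw [sub_sub_sub_cancel_right]
    exact hb
  rw [← hf]
  symm
  apply Finset.sum_eq_add i j hij
  · intro k _ hk
    rw [hz k hk.1 hk.2, zero_mul]
  · simp
  · simp

theorem two_coord {c d : ℕ} {h : Fin (r + 1) → List (Fin c)}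
    {h' : Fin (r + 1) → List (Fin d)}
    (hr : morphRank h = r) (hr' : morphRank h' = r) {i j : Fin (r + 1)} (hij : i ≠ j)
    (hi : h i = []) (hj : h' j = []) (hE : IsSolutionE h E) (hE' : IsSolutionE h' E)
    (hF : IsSolutionE h E') (hF' : IsSolutionE h' E') (k l : Fin (r + 1)) :
    tt E E' k l = 0 := by
  obtain ⟨z, f⟩ := two_coord_aux hr hr' hij hi hj hE hE'
  obtain ⟨z', f'⟩ := two_coord_aux hr hr' hij hi hj hF hF'
  have hX : (X j - 1 : MvPolynomial (Fin (r + 1)) ℤ) ≠ 0 := by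
    intro e
    have := congrArg constantCoeff e
    simp at this
  have hm : SS E i * SS E' j - SS E j * SS E' i = 0 := by
    apply mul_left_cancel₀ hX
    linear_combination SS E i * f' - SS E' i * f
  unfold tt
  by_cases hki : k = i
  · by_cases hli : l = i
    · subst hki hli; ring
    · by_cases hlj : l = j
      · subst hki hlj; exact hm
      · rw [z l hli hlj, z' l hli hlj]; ring
  · by_cases hkj : k = j
    · by_cases hli : l = i
      · subst hkj hli; linear_combination -hm
      · by_cases hlj : l = j
        · subst hkj hlj; ring
        · rw [z l hli hlj, z' l hli hlj]; ring
    · rw [z k hki hkj, z' k hki hkj]; ring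

end Minors

theorem antichain_card_sum {n : ℕ} (k l : Fin n) (u v u' v' : List (Fin n))
    (M : Finset (Fin n →₀ ℕ)) (hM : ∀ α ∈ M, ∀ β ∈ M, β ≤ α → β = α)
    (hsub : ∀ α ∈ M, ∃ x ∈ chainSet k u ∪ chainSet k v, ∃ y ∈ chainSet l u' ∪ chainSet l v',
      α = x + y) :
    M.card ≤ 2 * (u.count k + v.count k) ∧
    M.card ≤ (u.count k + v.count k) + (u'.count l + v'.count l) := by
  classical
  have key : ∀ w w' : List (Fin n),
      (M.filter (fun α => ∃ x ∈ chainSet k w, ∃ y ∈ chainSet l w', α = x + y)).card ≤ w.count k ∧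
      (M.filter (fun α => ∃ x ∈ chainSet k w, ∃ y ∈ chainSet l w', α = x + y)).card ≤
        w'.count l := by
    intro w w'
    constructor
    · refine le_trans (antichain_card _ (chainSet k w) (chainSet l w') ?_ (chainSet_chain l w') ?_)
        (chainSet_card k w)
      · intro α hα β hβ
        exact hM α (Finset.mem_filter.mp hα).1 β (Finset.mem_filter.mp hβ).1
      · intro α hα
        exact (Finset.mem_filter.mp hα).2
    · refine le_trans (antichain_card _ (chainSet l w') (chainSet k w) ?_ (chainSet_chain k w) ?_)
        (chainSet_card l w')
      · intro α hα β hβ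
        exact hM α (Finset.mem_filter.mp hα).1 β (Finset.mem_filter.mp hβ).1
      · intro α hα
        obtain ⟨x, hx, y, hy, e⟩ := (Finset.mem_filter.mp hα).2
        exact ⟨y, hy, x, hx, by rw [e, add_comm]⟩
  set f : List (Fin n) → List (Fin n) → Finset (Fin n →₀ ℕ) := fun w w' =>
    M.filter (fun α => ∃ x ∈ chainSet k w, ∃ y ∈ chainSet l w', α = x + y) with hf
  have hle : M ⊆ (f u u' ∪ f u v') ∪ (f v u' ∪ f v v') := by
    intro α hα
    obtain ⟨x, hx, y, hy, e⟩ := hsub α hα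
    simp only [hf, Finset.mem_union, Finset.mem_filter] at hx hy ⊢
    rcases hx with hx | hx <;> rcases hy with hy | hy
    · exact Or.inl (Or.inl ⟨hα, x, hx, y, hy, e⟩)
    · exact Or.inl (Or.inr ⟨hα, x, hx, y, hy, e⟩)
    · exact Or.inr (Or.inl ⟨hα, x, hx, y, hy, e⟩)
    · exact Or.inr (Or.inr ⟨hα, x, hx, y, hy, e⟩)
  have h0 := Finset.card_le_card hle
  have h1 := Finset.card_union_le (f u u' ∪ f u v') (f v u' ∪ f v v')
  have h2 := Finset.card_union_le (f u u') (f u v')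
  have h3 := Finset.card_union_le (f v u') (f v v')
  have k1 : (f u u').card ≤ _ ∧ (f u u').card ≤ _ := key u u'
  have k2 : (f u v').card ≤ _ ∧ (f u v').card ≤ _ := key u v'
  have k3 : (f v u').card ≤ _ ∧ (f v u').card ≤ _ := key v u'
  have k4 : (f v v').card ≤ _ ∧ (f v v').card ≤ _ := key v v'
  omega

theorem tt_minimal_card {n : ℕ} (E E' : List (Fin n) × List (Fin n)) (k l : Fin n) :
    ((tt E E' k l).support.filter
      (fun α => ∀ β ∈ (tt E E' k l).support, β ≤ α → β = α)).card ≤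
      2 * ((E.1.count k + E.2.count k) + (E.1.count l + E.2.count l)) ∧
    ((tt E E' k l).support.filter
      (fun α => ∀ β ∈ (tt E E' k l).support, β ≤ α → β = α)).card ≤
      ((E.1.count k + E.2.count k) + (E'.1.count l + E'.2.count l)) +
      ((E.1.count l + E.2.count l) + (E'.1.count k + E'.2.count k)) := by
  classical
  set M := (tt E E' k l).support.filter
      (fun α => ∀ β ∈ (tt E E' k l).support, β ≤ α → β = α) with hMdef
  have hM : ∀ α ∈ M, ∀ β ∈ M, β ≤ α → β = α := fun α hα β hβ =>
    (Finset.mem_filter.mp hα).2 β (Finset.mem_filter.mp hβ).1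
  set P : Fin n → Fin n → (Fin n →₀ ℕ) → Prop := fun k l α =>
    ∃ x ∈ chainSet k E.1 ∪ chainSet k E.2, ∃ y ∈ chainSet l E'.1 ∪ chainSet l E'.2, α = x + y
    with hP
  have hmul : ∀ k l, ∀ α ∈ (SS E k * SS E' l).support, P k l α := by
    intro k l α hα
    have := MvPolynomial.support_mul _ _ hα
    obtain ⟨x, hx, y, hy, e⟩ := Finset.mem_add.mp this
    exact ⟨x, SS_support E k hx, y, SS_support E' l hy, e.symm⟩
  have hcov : M ⊆ M.filter (P k l) ∪ M.filter (P l k) := by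
    intro α hα
    have h1 := (Finset.mem_filter.mp hα).1
    rw [tt] at h1
    rcases Finset.mem_union.mp (MvPolynomial.support_sub _ _ _ h1) with h2 | h2
    · exact Finset.mem_union_left _ (Finset.mem_filter.mpr ⟨hα, hmul k l α h2⟩)
    · exact Finset.mem_union_right _ (Finset.mem_filter.mpr ⟨hα, hmul l k α h2⟩)
  have hc := (Finset.card_le_card hcov).trans (Finset.card_union_le _ _)
  have hb : ∀ k l, _ := fun k l => antichain_card_sum k l E.1 E.2 E'.1 E'.2 (M.filter (P k l))
    (fun α hα β hβ => hM α (Finset.mem_filter.mp hα).1 β (Finset.mem_filter.mp hβ).1)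
    (fun α hα => (Finset.mem_filter.mp hα).2)
  have b1 := hb k l
  have b2 := hb l k
  omega

theorem count_add_le {n : ℕ} (k l : Fin n) (hkl : k ≠ l) (w : List (Fin n)) :
    w.count k + w.count l ≤ w.length := by
  induction w with
  | nil => simp
  | cons b w ih =>
    simp only [List.count_cons, List.length_cons, beq_iff_eq]
    split_ifs with h1 h2
    · exact absurd (h1.symm.trans h2) hkl
    all_goals omega

/-- a strongly independent pair `E`, `E'` of equations in `n` unknowns has
at most `|E| + |E'|` pairwise linearly nonequivalent solutions of rank `n-1`, and there are
indices `k < ℓ` with this number bounded by `2(|E|_{x_k} + |E|_{x_ℓ})`. -/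
theorem bound_nonequivalent_solutions {n : ℕ} (E E' : List (Fin n) × List (Fin n))
    (hind₁ : ∃ (c : ℕ) (g : Fin n → List (Fin c)),
      IsSolutionE g E ∧ ¬ IsSolutionE g E' ∧ morphRank g = n - 1)
    (hind₂ : ∃ (c : ℕ) (g : Fin n → List (Fin c)),
      IsSolutionE g E' ∧ ¬ IsSolutionE g E ∧ morphRank g = n - 1)
    (m : ℕ) (K : Fin m → ℕ) (h : (i : Fin m) → Fin n → List (Fin (K i)))
    (hsolE : ∀ i, IsSolutionE (h i) E) (hsolE' : ∀ i, IsSolutionE (h i) E')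
    (hrank : ∀ i, morphRank (h i) = n - 1)
    (hneq : ∀ i j, i ≠ j → GammaSpace (h i) ≠ GammaSpace (h j)) :
    m ≤ (E.1.length + E.2.length) + (E'.1.length + E'.2.length) ∧
    ∃ k ℓ : Fin n, k < ℓ ∧
      m ≤ 2 * ((E.1.count k + E.2.count k) + (E.1.count ℓ + E.2.count ℓ)) := by
  classical
  have hne : E.1 ≠ E.2 := by
    obtain ⟨c, g, _, hg, _⟩ := hind₂
    intro e
    exact hg (by unfold IsSolutionE; rw [e])
  rcases n with _ | r
  · exact absurd (by
      rw [List.eq_nil_iff_forall_not_mem (l := E.1) |>.mpr (fun a => a.elim0),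
        List.eq_nil_iff_forall_not_mem (l := E.2) |>.mpr (fun a => a.elim0)]) hne
  simp only [Nat.add_sub_cancel] at hind₁ hrank
  obtain ⟨c, g, hgE, hgE', hgr⟩ := hind₁
  obtain ⟨k, l, hkl, ht⟩ : ∃ k l, k < l ∧ tt E E' k l ≠ 0 := by
    obtain ⟨k, l, ht⟩ := exists_tt hgr hgE hgE' hne
    rcases lt_trichotomy k l with hlt | heq | hgt
    · exact ⟨k, l, hlt, ht⟩
    · subst heq
      exact absurd (by unfold tt; ring) ht
    · refine ⟨l, k, hgt, fun e => ht ?_⟩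
      unfold tt at e ⊢
      linear_combination -e
  obtain ⟨hc1, hc2⟩ := tt_minimal_card E E' k l
  have hlow : m ≤ ((tt E E' k l).support.filter
      (fun α => ∀ β ∈ (tt E E' k l).support, β ≤ α → β = α)).card := by
    choose lam hl0 hlp hlm using fun i => exists_lambda (hrank i)
    have hmain := many_minimal (I := {i : Fin m // ∀ x, h i x ≠ []}) (tt E E' k l).support
      (Finset.nonempty_iff_ne_empty.mpr (fun e => ht (MvPolynomial.support_eq_empty.mp e)))
      (fun i => K i.1) (fun i => h i.1) (fun i => lam i.1) (fun i => hlm i.1) (fun i => hl0 i.1)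
      (by
        intro i j hij hp
        apply hneq i.1 j.1 (fun e => hij (Subtype.ext e))
        apply le_antisymm
        · intro x hx
          exact mem_of_perp (hrank j.1) (hl0 j.1) (hlp j.1) (perp_space hp hx)
        · intro x hx
          exact mem_of_perp (hrank i.1) (hl0 j.1) hp (perp_space (hlp j.1) hx))
      (fun i => i.2)
      (fun i α hα => exists_other (h i.1) _
        (subst_tt (hrank i.1) (hsolE i.1) (hsolE' i.1) k l) α hα)
    refine le_trans ?_ hmain
    have hsub : Fintype.card {i : Fin m // ¬ ∀ x, h i x ≠ []} ≤ 1 := by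
      rw [Fintype.card_le_one_iff]
      rintro ⟨i, hi⟩ ⟨j, hj⟩
      push Not at hi hj
      obtain ⟨x, hx⟩ := hi
      obtain ⟨y, hy⟩ := hj
      by_contra hij
      have hij' : i ≠ j := fun e => hij (Subtype.ext e)
      by_cases hxy : x = y
      · subst hxy
        apply hneq i j hij'
        have hp : ∀ i, h i x = [] → ∀ a, gamVec (h i) a ⬝ᵥ (Pi.single x 1) = 0 := by
          intro i hx a
          simp [gamVec, hx]
        have h0 : (Pi.single x 1 : Fin (r + 1) → ℚ) ≠ 0 := by simp
        apply le_antisymm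
        · intro v hv
          exact mem_of_perp (hrank j) h0 (hp j hy) (perp_space (hp i hx) hv)
        · intro v hv
          exact mem_of_perp (hrank i) h0 (hp i hx) (perp_space (hp j hy) hv)
      · exact ht (two_coord (hrank i) (hrank j) hxy hx hy (hsolE i) (hsolE j) (hsolE' i)
          (hsolE' j) k l)
    have hcompl := Fintype.card_subtype_compl (fun i : Fin m => ∀ x, h i x ≠ [])
    rw [Fintype.card_fin] at hcompl
    omega
  have hkl' : k ≠ l := ne_of_lt hkl
  have c1 := count_add_le k l hkl' E.1
  have c2 := count_add_le k l hkl' E.2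
  have c3 := count_add_le k l hkl' E'.1
  have c4 := count_add_le k l hkl' E'.2
  exact ⟨by omega, k, l, hkl, by omega⟩

end WordEquations
end
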